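/- Let A be a finite dimensional algebra over an algebraically closed field k of finite representation type and f: X → Y an irreducible morphism with X or Y indecomposable. Then the following are equivalent: (a) d_l(f) < ∞; (b) d_r(f) = ∞; (c) f is an epimorphism. -/

import Mathlib

/-! Background definitions: the category `mod A` of finite dimensional modules over a
finite dimensional algebra `A` over an algebraically closed field `k`, its radical and
radical powers, irreducible morphisms, left and right degrees of irreducible morphisms,
(minimal) almost split morphisms and almost split sequences, and the Auslander-Reiten
components (as the "same component" relation). -/

open CategoryTheory



namespace ARDegree

variable (k : Type) [Field k] (A : Type) [Ring A] [Algebra k A]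

/-- The (big) category of `A`-modules. -/
abbrev Mod := ModuleCat.{0} A

variable {A}

/-- `M` is an object of `mod A`, i.e. a finite dimensional (equivalently, finitely
generated) `A`-module. -/
def FD (M : Mod A) : Prop := Module.Finite A M

/-- `f` belongs to the (Jacobson) radical of the module category. -/
def IsRadMor {X Y : Mod A} (f : X ⟶ Y) : Prop := ∀ g : Y ⟶ X, IsIso (𝟙 X - f ≫ g)

/-- `f` is a composite of `n` radical morphisms between finite dimensional modules. -/
inductive RadComp : ℕ → ∀ (X Y : Mod A), (X ⟶ Y) → Prop
  | zero {X Y : Mod A} (f : X ⟶ Y) : RadComp 0 X Y f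
  | succ {X Y Z : Mod A} {n : ℕ} {f : X ⟶ Y} {g : Y ⟶ Z} (hY : FD Y) (hf : IsRadMor f)
      (hg : RadComp n Y Z g) : RadComp (n + 1) X Z (f ≫ g)

/-- The `n`-th power `rad^n(X,Y)` of the radical of `mod A`; by convention
`rad^0(X,Y) = Hom(X,Y)`. -/
def radPow (n : ℕ) (X Y : Mod A) : Submodule k (X ⟶ Y) :=
  Submodule.span k {f : X ⟶ Y | RadComp n X Y f}

/-- `rad^∞(X,Y)`, the intersection of all powers of the radical. -/
def radInf (X Y : Mod A) : Submodule k (X ⟶ Y) := ⨅ n : ℕ, radPow k n X Y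

/-- A morphism of `mod A` is irreducible if it is neither a split monomorphism nor a split
epimorphism and, in any factorization through a finite dimensional module, the first factor
is a split monomorphism or the second factor is a split epimorphism. -/
def Irred {X Y : Mod A} (f : X ⟶ Y) : Prop :=
  ¬ IsSplitMono f ∧ ¬ IsSplitEpi f ∧
    ∀ (Z : Mod A), FD Z → ∀ (g : X ⟶ Z) (h : Z ⟶ Y), g ≫ h = f → IsSplitMono g ∨ IsSplitEpi h

/-- `X` is an indecomposable module. -/
def Indec (X : Mod A) : Prop :=
  ¬ Limits.IsZero X ∧ ∀ e : X ⟶ X, e ≫ e = e → e = 0 ∨ e = 𝟙 X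

/-- `m` is a bound witnessing finiteness of the left degree of `f`, i.e. `m ≥ 1` and there are
a module `Z` in `mod A` and `g ∈ rad^m(Z,X) ∖ rad^{m+1}(Z,X)` with `f ∘ g ∈ rad^{m+2}(Z,Y)`. -/
def LeftDegBound {X Y : Mod A} (f : X ⟶ Y) (m : ℕ) : Prop :=
  1 ≤ m ∧ ∃ (Z : Mod A), FD Z ∧ ∃ g : Z ⟶ X,
    g ∈ radPow k m Z X ∧ g ∉ radPow k (m + 1) Z X ∧ g ≫ f ∈ radPow k (m + 2) Z Y

/-- The left degree `d_l(f) ∈ ℕ∞` of a morphism. -/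
noncomputable def leftDeg {X Y : Mod A} (f : X ⟶ Y) : ℕ∞ :=
  sInf {n : ℕ∞ | ∃ m : ℕ, n = (m : ℕ∞) ∧ LeftDegBound k f m}

/-- `m` is a bound witnessing finiteness of the right degree of `f`. -/
def RightDegBound {X Y : Mod A} (f : X ⟶ Y) (m : ℕ) : Prop :=
  1 ≤ m ∧ ∃ (Z : Mod A), FD Z ∧ ∃ g : Y ⟶ Z,
    g ∈ radPow k m Y Z ∧ g ∉ radPow k (m + 1) Y Z ∧ f ≫ g ∈ radPow k (m + 2) X Z

/-- The right degree `d_r(f) ∈ ℕ∞` of a morphism. -/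
noncomputable def rightDeg {X Y : Mod A} (f : X ⟶ Y) : ℕ∞ :=
  sInf {n : ℕ∞ | ∃ m : ℕ, n = (m : ℕ∞) ∧ RightDegBound k f m}

/-- `f : X ⟶ Y` is a left almost split morphism in `mod A`. -/
def IsLeftAS {X Y : Mod A} (f : X ⟶ Y) : Prop :=
  ¬ IsSplitMono f ∧
    ∀ (Z : Mod A), FD Z → ∀ g : X ⟶ Z, ¬ IsSplitMono g → ∃ h : Y ⟶ Z, f ≫ h = g

/-- `f : X ⟶ Y` is a minimal left almost split morphism in `mod A`. -/
def IsMinLeftAS {X Y : Mod A} (f : X ⟶ Y) : Prop :=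
  IsLeftAS f ∧ ∀ h : Y ⟶ Y, f ≫ h = f → IsIso h

/-- `f : X ⟶ Y` is a right almost split morphism in `mod A`. -/
def IsRightAS {X Y : Mod A} (f : X ⟶ Y) : Prop :=
  ¬ IsSplitEpi f ∧
    ∀ (Z : Mod A), FD Z → ∀ g : Z ⟶ Y, ¬ IsSplitEpi g → ∃ h : Z ⟶ X, h ≫ f = g

/-- `f : X ⟶ Y` is a minimal right almost split morphism in `mod A`. -/
def IsMinRightAS {X Y : Mod A} (f : X ⟶ Y) : Prop :=
  IsRightAS f ∧ ∀ h : X ⟶ X, h ≫ f = f → IsIso h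

/-- `0 → L → M → N → 0` (given by the two maps `f,g`) is an almost split
(Auslander-Reiten) sequence in `mod A`. -/
structure IsASSeq {L M N : Mod A} (f : L ⟶ M) (g : M ⟶ N) : Prop where
  fdL : FD L
  fdM : FD M
  fdN : FD N
  indecL : Indec L
  indecN : Indec N
  inj : Function.Injective f
  surj : Function.Surjective g
  exact : ∀ m : M, g m = 0 ↔ ∃ l : L, f l = m
  minLeft : IsMinLeftAS f
  minRight : IsMinRightAS g

/-- Two modules are joined by an edge of the Auslander-Reiten quiver of `A` (or are
isomorphic, hence are equal vertices of it). -/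
def ARStep (X Y : Mod A) : Prop :=
  (FD X ∧ FD Y ∧ Indec X ∧ Indec Y ∧
    ((∃ f : X ⟶ Y, Irred f) ∨ (∃ f : Y ⟶ X, Irred f))) ∨ Nonempty (X ≅ Y)

/-- `X` and `Y` lie in the same component of the Auslander-Reiten quiver of `A`. -/
def SameComp : Mod A → Mod A → Prop := Relation.EqvGen ARStep

/-- The radical of a module: the intersection of its maximal submodules. -/
def modRad (M : Mod A) : Submodule A M := sInf {N : Submodule A M | IsCoatom N}

/-- The socle of a module: the sum of its simple submodules. -/
def modSoc (M : Mod A) : Submodule A M := sSup {N : Submodule A M | IsAtom N}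

variable (A) in
/-- `A` is of finite representation type. -/
def FinRepType : Prop := ∃ (ι : Type) (_ : Finite ι) (M : ι → Mod A),
  ∀ X : Mod A, FD X → Indec X → ∃ i : ι, Nonempty (X ≅ M i)

variable (A) in
/-- `A` is a connected (indecomposable) algebra: its only central idempotents are `0`, `1`. -/
def ConnectedAlgebra : Prop :=
  ∀ e : A, IsIdempotentElem e → (∀ a : A, a * e = e * a) → e = 0 ∨ e = 1

end ARDegree

namespace ARDegree

open Limits

universe w v u

section Radical

variable {C : Type u} [Category.{v} C] [Preadditive C]

/-- `f` belongs to the Jacobson radical of the preadditive category `C`. -/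
def Rad {X Y : C} (f : X ⟶ Y) : Prop := ∀ g : Y ⟶ X, IsIso (𝟙 X - f ≫ g)

lemma isIso_one_sub_swap {X Y : C} {f : X ⟶ Y} {g : Y ⟶ X} (h : IsIso (𝟙 X - f ≫ g)) :
    IsIso (𝟙 Y - g ≫ f) := by
  obtain ⟨i, h1, h2⟩ := h
  have h1' : i - f ≫ g ≫ i = 𝟙 X := by simpa [Preadditive.sub_comp] using h1
  have h2' : i - i ≫ f ≫ g = 𝟙 X := by simpa [Preadditive.comp_sub] using h2
  refine ⟨𝟙 Y + g ≫ i ≫ f, ?_, ?_⟩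
  · have : g ≫ (i - f ≫ g ≫ i) ≫ f = g ≫ f := by rw [h1']; simp
    simp only [Preadditive.sub_comp, Preadditive.comp_sub, Category.assoc] at this
    simp only [Preadditive.sub_comp, Preadditive.comp_add, Category.assoc, Category.id_comp,
      Category.comp_id]
    rw [← this]; abel
  · have : g ≫ (i - i ≫ f ≫ g) ≫ f = g ≫ f := by rw [h2']; simp
    simp only [Preadditive.sub_comp, Preadditive.comp_sub, Category.assoc] at this
    simp only [Preadditive.comp_sub, Preadditive.add_comp, Category.assoc, Category.id_comp,
      Category.comp_id]
    rw [sub_eq_iff_eq_add.1 this]; abel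

lemma Rad.swap {X Y : C} {f : X ⟶ Y} (h : Rad f) (g : Y ⟶ X) : IsIso (𝟙 Y - g ≫ f) :=
  isIso_one_sub_swap (h g)

lemma rad_of_swap {X Y : C} {f : X ⟶ Y} (h : ∀ g : Y ⟶ X, IsIso (𝟙 Y - g ≫ f)) : Rad f :=
  fun g ↦ isIso_one_sub_swap (h g)

lemma Rad.comp_right {X Y Z : C} {f : X ⟶ Y} (hf : Rad f) (h : Y ⟶ Z) : Rad (f ≫ h) := fun g ↦ by
  simpa using hf (h ≫ g)

lemma Rad.comp_left {X Y Z : C} {f : X ⟶ Y} (hf : Rad f) (h : Z ⟶ X) : Rad (h ≫ f) :=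
  rad_of_swap fun g ↦ by simpa using hf.swap (g ≫ h)

lemma Rad.zero (X Y : C) : Rad (0 : X ⟶ Y) := fun g ↦ by
  simpa using (inferInstance : IsIso (𝟙 X))

lemma Rad.add {X Y : C} {f f' : X ⟶ Y} (hf : Rad f) (hf' : Rad f') : Rad (f + f') := fun g ↦ by
  have h1 := hf g
  have h2 := (hf'.comp_left (inv (𝟙 X - f ≫ g))) g
  have : 𝟙 X - (f + f') ≫ g =
      (𝟙 X - f ≫ g) ≫ (𝟙 X - (inv (𝟙 X - f ≫ g) ≫ f') ≫ g) := by
    rw [Preadditive.comp_sub]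
    simp only [Category.assoc, IsIso.hom_inv_id_assoc, Category.comp_id, Preadditive.add_comp]
    abel
  rw [this]
  infer_instance

lemma Rad.neg {X Y : C} {f : X ⟶ Y} (hf : Rad f) : Rad (-f) := by
  simpa using hf.comp_right (-𝟙 Y)

lemma Rad.sum {ι : Type*} {X Y : C} (s : Finset ι) {f : ι → (X ⟶ Y)} (hf : ∀ i ∈ s, Rad (f i)) :
    Rad (∑ i ∈ s, f i) :=
  Finset.sum_induction f Rad (fun _ _ ↦ Rad.add) (Rad.zero _ _) hf

/-- A radical morphism is not a split monomorphism, unless its source is zero. -/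
lemma Rad.eq_zero_of_comp_eq_id {X Y : C} {f : X ⟶ Y} (hf : Rad f) {g : Y ⟶ X}
    (h : f ≫ g = 𝟙 X) : 𝟙 X = 0 := by
  have := hf g
  rw [h, sub_self] at this
  rw [← IsIso.hom_inv_id (0 : X ⟶ X), zero_comp]

lemma rad_op_iff {X Y : C} (f : X ⟶ Y) : Rad f.op ↔ Rad f := by
  constructor
  · intro h
    refine rad_of_swap fun g ↦ ?_
    have := h g.op
    have e : 𝟙 (Opposite.op Y) - f.op ≫ g.op = (𝟙 Y - g ≫ f).op := by simp
    rw [e, isIso_op_iff] at this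
    exact this
  · intro h g
    have := h.swap g.unop
    have e : 𝟙 (Opposite.op Y) - f.op ≫ g = (𝟙 Y - g.unop ≫ f).op := by simp
    rw [e, isIso_op_iff]
    exact this

variable (k : Type w) [Field k] [Linear k C]

/-- The radical as a linear subspace of the morphism space. -/
def radSub (X Y : C) : Submodule k (X ⟶ Y) where
  carrier := {f | Rad f}
  zero_mem' := Rad.zero X Y
  add_mem' := Rad.add
  smul_mem' c f hf := by
    have := Rad.comp_right (show Rad f from hf) (c • 𝟙 Y)
    simpa using this

@[simp] lemma mem_radSub {X Y : C} {f : X ⟶ Y} : f ∈ radSub k X Y ↔ Rad f := Iff.rfl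

/-- The powers of the radical of a linear category. -/
def rpow : ℕ → ∀ X Y : C, Submodule k (X ⟶ Y)
  | 0, _, _ => ⊤
  | n + 1, X, Z => Submodule.span k
      {h | ∃ (Y : C) (f : X ⟶ Y) (g : Y ⟶ Z), Rad f ∧ g ∈ rpow n Y Z ∧ f ≫ g = h}

variable {k}

@[simp] lemma mem_rpow_zero {X Y : C} (f : X ⟶ Y) : f ∈ rpow k 0 X Y := Submodule.mem_top

lemma comp_mem_rpow_succ {n : ℕ} {X Y Z : C} {f : X ⟶ Y} {g : Y ⟶ Z} (hf : Rad f)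
    (hg : g ∈ rpow k n Y Z) : f ≫ g ∈ rpow k (n + 1) X Z :=
  Submodule.subset_span ⟨Y, f, g, hf, hg, rfl⟩

/-- Induction principle for the powers of the radical. -/
lemma rpow_succ_le {n : ℕ} {X Z : C} {S : Submodule k (X ⟶ Z)}
    (h : ∀ (Y : C) (f : X ⟶ Y) (g : Y ⟶ Z), Rad f → g ∈ rpow k n Y Z → f ≫ g ∈ S) :
    rpow k (n + 1) X Z ≤ S := by
  rw [rpow, Submodule.span_le]
  rintro _ ⟨Y, f, g, hf, hg, rfl⟩
  exact h Y f g hf hg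

lemma rpow_comp_right {n : ℕ} {X Y Z : C} {f : X ⟶ Y} (hf : f ∈ rpow k n X Y) (g : Y ⟶ Z) :
    f ≫ g ∈ rpow k n X Z := by
  induction n generalizing X with
  | zero => simp
  | succ n ih =>
    have : rpow k (n + 1) X Y ≤ (rpow k (n + 1) X Z).comap (Linear.rightComp k X g) :=
      rpow_succ_le fun W a b ha hb ↦ by
        simpa using comp_mem_rpow_succ ha (ih hb)
    exact this hf

lemma rpow_comp_left {n : ℕ} {X Y Z : C} {f : X ⟶ Y} (hf : f ∈ rpow k n X Y) (g : Z ⟶ X) :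
    g ≫ f ∈ rpow k n Z Y := by
  cases n with
  | zero => simp
  | succ n =>
    have : rpow k (n + 1) X Y ≤ (rpow k (n + 1) Z Y).comap (Linear.leftComp k Y g) :=
      rpow_succ_le fun W a b ha hb ↦ by
        simpa using comp_mem_rpow_succ (ha.comp_left g) hb
    exact this hf

lemma rpow_succ_le_self (n : ℕ) (X Y : C) : rpow k (n + 1) X Y ≤ rpow k n X Y :=
  rpow_succ_le fun _ f _ _ hg ↦ rpow_comp_left hg f

lemma rpow_antitone (X Y : C) : Antitone fun n ↦ rpow k n X Y :=
  antitone_nat_of_succ_le fun n ↦ rpow_succ_le_self n X Y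

@[simp] lemma mem_rpow_one {X Y : C} {f : X ⟶ Y} : f ∈ rpow k 1 X Y ↔ Rad f := by
  constructor
  · intro h
    have : rpow k 1 X Y ≤ radSub k X Y := rpow_succ_le fun _ _ g hf _ ↦ hf.comp_right g
    exact this h
  · intro h
    simpa using comp_mem_rpow_succ (k := k) (n := 0) h (g := 𝟙 Y) (by simp)

lemma comp_mem_rpow_add {m n : ℕ} {X Y Z : C} {f : X ⟶ Y} {g : Y ⟶ Z}
    (hf : f ∈ rpow k m X Y) (hg : g ∈ rpow k n Y Z) : f ≫ g ∈ rpow k (m + n) X Z := by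
  induction m generalizing X with
  | zero => simpa using rpow_comp_left hg f
  | succ m ih =>
    have : rpow k (m + 1) X Y ≤ (rpow k (m + 1 + n) X Z).comap (Linear.rightComp k X g) :=
      rpow_succ_le fun W a b ha hb ↦ by
        have := comp_mem_rpow_succ ha (ih hb)
        rw [show m + 1 + n = m + n + 1 by omega]
        simpa using this
    exact this hf

lemma comp_mem_rpow_succ' {n : ℕ} {X Y Z : C} {f : X ⟶ Y} {g : Y ⟶ Z}
    (hf : f ∈ rpow k n X Y) (hg : Rad g) : f ≫ g ∈ rpow k (n + 1) X Z :=
  comp_mem_rpow_add hf (mem_rpow_one.2 hg)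

/-- Induction principle for the powers of the radical, splitting off the last factor. -/
lemma rpow_succ_le' {n : ℕ} {X Z : C} {S : Submodule k (X ⟶ Z)}
    (h : ∀ (Y : C) (f : X ⟶ Y) (g : Y ⟶ Z), f ∈ rpow k n X Y → Rad g → f ≫ g ∈ S) :
    rpow k (n + 1) X Z ≤ S := by
  induction n generalizing X with
  | zero => exact fun f hf ↦ by simpa using h X (𝟙 X) f (by simp) (mem_rpow_one.1 hf)
  | succ n ih =>
    refine rpow_succ_le fun Y f g hf hg ↦ ?_
    have : rpow k (n + 1) Y Z ≤ S.comap (Linear.leftComp k Z f) := ih fun W a b ha hb ↦ by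
      have := h W (f ≫ a) b (comp_mem_rpow_succ hf ha) hb
      simpa using this
    exact this hg

/-- The linear structure on the opposite of a linear category. -/
instance opLinear : Linear k Cᵒᵖ where
  homModule X Y :=
    { smul c f := (c • f.unop).op
      one_smul f := Quiver.Hom.unop_inj (one_smul k f.unop)
      mul_smul a b f := Quiver.Hom.unop_inj (mul_smul a b f.unop)
      smul_zero a := Quiver.Hom.unop_inj (smul_zero (A := Y.unop ⟶ X.unop) a)
      smul_add a f g := Quiver.Hom.unop_inj (smul_add a f.unop g.unop)
      add_smul a b f := Quiver.Hom.unop_inj (add_smul a b f.unop)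
      zero_smul f := Quiver.Hom.unop_inj (zero_smul k f.unop) }
  smul_comp _ _ _ r f g := Quiver.Hom.unop_inj (Linear.comp_smul _ _ _ g.unop r f.unop)
  comp_smul _ _ _ f r g := Quiver.Hom.unop_inj (Linear.smul_comp _ _ _ r g.unop f.unop)

/-- Passing to the opposite category, as a linear equivalence. -/
def opHomEquiv (X Y : C) : (X ⟶ Y) ≃ₗ[k] (Opposite.op Y ⟶ Opposite.op X) where
  toFun := Quiver.Hom.op
  invFun := Quiver.Hom.unop
  map_add' _ _ := rfl
  map_smul' _ _ := rfl
  left_inv _ := rfl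
  right_inv _ := rfl

lemma op_mem_rpow {n : ℕ} {X Y : C} {f : X ⟶ Y} (hf : f ∈ rpow k n X Y) :
    f.op ∈ rpow k n (Opposite.op Y) (Opposite.op X) := by
  induction n generalizing X Y with
  | zero => simp
  | succ n ih =>
    have : rpow k (n + 1) X Y ≤ (rpow k (n + 1) (Opposite.op Y) (Opposite.op X)).comap
        (opHomEquiv X Y).toLinearMap :=
      rpow_succ_le' fun W a b ha hb ↦ by
        exact comp_mem_rpow_succ ((rad_op_iff b).2 hb) (ih ha)
    exact this hf

lemma unop_mem_rpow {n : ℕ} {X Y : Cᵒᵖ} {f : X ⟶ Y} (hf : f ∈ rpow k n X Y) :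
    f.unop ∈ rpow k n Y.unop X.unop := by
  induction n generalizing X Y with
  | zero => simp
  | succ n ih =>
    have : rpow k (n + 1) X Y ≤ (rpow k (n + 1) Y.unop X.unop).comap
        (opHomEquiv Y.unop X.unop).symm.toLinearMap :=
      rpow_succ_le' fun W a b ha hb ↦ by
        exact comp_mem_rpow_succ ((rad_op_iff b.unop).1 hb) (ih ha)
    exact this hf

end Radical

/-- A non-nilpotent element of a finite dimensional algebra has a multiple which is a nonzero
idempotent. -/
lemma exists_idempotent_of_not_isNilpotent (k : Type*) {R : Type*} [Field k] [Ring R] [Algebra k R]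
    [FiniteDimensional k R] {t : R} (ht : ¬ IsNilpotent t) :
    ∃ p : R, Commute t p ∧ t * p ≠ 0 ∧ IsIdempotentElem (t * p) := by
  have hint : IsIntegral k t := Algebra.IsIntegral.isIntegral t
  obtain ⟨q, hq, hdvd⟩ := Polynomial.exists_eq_pow_rootMultiplicity_mul_and_not_dvd
    (minpoly k t) (minpoly.ne_zero hint) 0
  set n := (minpoly k t).rootMultiplicity 0
  have hX : Polynomial.X - Polynomial.C (0 : k) = Polynomial.X := by simp
  rw [hX] at hq hdvd
  have hcop : IsCoprime (Polynomial.X ^ (n + 1)) q :=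
    ((Polynomial.irreducible_X.coprime_iff_not_dvd).2 hdvd).pow_left
  obtain ⟨a, b, hab⟩ := hcop
  have hzero : t ^ n * Polynomial.aeval t q = 0 := by
    have := minpoly.aeval k t
    rw [hq] at this
    simpa using this
  have hc (r : Polynomial k) : Commute t (Polynomial.aeval t r) := by
    have := Polynomial.aeval_X (R := k) t
    nth_rewrite 1 [← this]
    exact (Commute.all (Polynomial.X : Polynomial k) r).map (Polynomial.aeval t)
  have hone : t * (t ^ n * Polynomial.aeval t a) +
      Polynomial.aeval t b * Polynomial.aeval t q = 1 := by
    have := congrArg (Polynomial.aeval t) hab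
    simp only [map_add, map_mul, map_pow, Polynomial.aeval_X, map_one] at this
    rwa [← mul_assoc, ← pow_succ', ((hc a).pow_left (n + 1)).eq]
  have hcq : Commute (Polynomial.aeval t q) (Polynomial.aeval t a) :=
    (Commute.all q a).map (Polynomial.aeval t)
  have hcb : Commute (Polynomial.aeval t b) (Polynomial.aeval t q) :=
    (Commute.all b q).map (Polynomial.aeval t)
  refine ⟨t ^ n * Polynomial.aeval t a, ?_, ?_, ?_⟩
  · exact ((Commute.refl t).pow_right n).mul_right (hc a)
  · intro h0
    rw [h0, zero_add] at hone
    refine ht ⟨n, ?_⟩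
    rw [← mul_one (t ^ n), ← hone, hcb.eq, ← mul_assoc, hzero, zero_mul]
  · have key : (t * (t ^ n * Polynomial.aeval t a)) *
        (Polynomial.aeval t b * Polynomial.aeval t q) = 0 := by
      have e : t ^ n * Polynomial.aeval t a * (Polynomial.aeval t b * Polynomial.aeval t q) =
          t ^ n * Polynomial.aeval t q * (Polynomial.aeval t a * Polynomial.aeval t b) := by
        rw [hcb.eq, mul_assoc, ← mul_assoc (Polynomial.aeval t a), ← hcq.eq]
        simp only [mul_assoc]
      rw [mul_assoc, e, hzero, zero_mul, mul_zero]
    rw [IsIdempotentElem]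
    rw [← eq_sub_iff_add_eq'] at hone
    rw [hone, mul_sub, mul_one, sub_eq_zero] at key
    exact key.symm

section Indecomposable

variable {C : Type u} [Category.{v} C] [Preadditive C]

/-- Indecomposable objects: the only idempotent endomorphisms are `0` and `1`, which differ. -/
def CIndec (X : C) : Prop := 𝟙 X ≠ 0 ∧ ∀ e : X ⟶ X, e ≫ e = e → e = 0 ∨ e = 𝟙 X

variable (k : Type w) [Field k] [Linear k C] [hfin : ∀ X Y : C, FiniteDimensional k (X ⟶ Y)]

include k hfin

lemma CIndec.isNilpotent {X : C} (hX : CIndec X) {t : X ⟶ X} (ht : ¬ IsIso t) :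
    IsNilpotent (End.of t) := by
  by_contra hn
  have : FiniteDimensional k (End X) := hfin X X
  obtain ⟨p, hc, hne, hid⟩ := exists_idempotent_of_not_isNilpotent k hn
  rcases hX.2 _ hid with h | h
  · exact hne h
  · refine ht ⟨p, ?_, ?_⟩
    · exact hc.eq.symm.trans h
    · exact h

lemma CIndec.isSplitMono_of_not_rad {X Y : C} (hX : CIndec X) {f : X ⟶ Y} (hf : ¬ Rad f) :
    ∃ g : Y ⟶ X, f ≫ g = 𝟙 X := by
  rw [Rad] at hf
  push Not at hf
  obtain ⟨g, hg⟩ := hf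
  have hu := (hX.isNilpotent k hg).isUnit_one_sub
  have : IsIso (f ≫ g) := by
    have e : End.of (f ≫ g) = 1 - End.of (𝟙 X - f ≫ g) :=
      (sub_sub_cancel (𝟙 X) (f ≫ g)).symm
    rw [← e] at hu
    exact (isUnit_iff_isIso _).1 hu
  exact ⟨g ≫ inv (f ≫ g), by rw [← Category.assoc, IsIso.hom_inv_id]⟩

lemma CIndec.isSplitEpi_of_not_rad {X Y : C} (hY : CIndec Y) {f : X ⟶ Y} (hf : ¬ Rad f) :
    ∃ g : Y ⟶ X, g ≫ f = 𝟙 Y := by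
  have : ∃ g : Y ⟶ X, ¬ IsIso (𝟙 Y - g ≫ f) := by
    by_contra! h
    exact hf (rad_of_swap h)
  obtain ⟨g, hg⟩ := this
  have hu := (hY.isNilpotent k hg).isUnit_one_sub
  have : IsIso (g ≫ f) := by
    have e : End.of (g ≫ f) = 1 - End.of (𝟙 Y - g ≫ f) :=
      (sub_sub_cancel (𝟙 Y) (g ≫ f)).symm
    rw [← e] at hu
    exact (isUnit_iff_isIso _).1 hu
  exact ⟨inv (g ≫ f) ≫ g, by rw [Category.assoc, IsIso.inv_hom_id]⟩

lemma CIndec.isIso_of_not_rad {X Y : C} (hX : CIndec X) (hY : CIndec Y) {f : X ⟶ Y}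
    (hf : ¬ Rad f) : IsIso f := by
  obtain ⟨g, hg⟩ := hX.isSplitMono_of_not_rad k hf
  obtain ⟨h, hh⟩ := hY.isSplitEpi_of_not_rad k hf
  have : g = h := by
    rw [← Category.id_comp g, ← hh, Category.assoc, hg, Category.comp_id]
  exact ⟨g, hg, this ▸ hh⟩

lemma isIso_of_mono_endo {X : C} (u : X ⟶ X) [Mono u] : IsIso u := by
  have hinj : Function.Injective (Linear.rightComp k X u) := fun a b h ↦ by
    exact (cancel_mono u).1 h
  obtain ⟨x, hx⟩ := LinearMap.surjective_of_injective hinj (𝟙 X)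
  have hx' : x ≫ u = 𝟙 X := hx
  exact ⟨x, by rw [← cancel_mono u, Category.assoc, hx', Category.comp_id, Category.id_comp], hx'⟩

variable {k} in
lemma CIndec.exists_rad_sub_smul [IsAlgClosed k] {X : C} (hX : CIndec X) (t : X ⟶ X) :
    ∃ c : k, Rad (t - c • 𝟙 X) := by
  have : FiniteDimensional k (End X) := hfin X X
  have : Nontrivial (End X) := ⟨𝟙 X, 0, hX.1⟩
  obtain ⟨c, hc⟩ := spectrum.nonempty_of_isAlgClosed_of_finiteDimensional k (End.of t)
  refine ⟨c, ?_⟩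
  by_contra hn
  have hi : IsIso (t - c • 𝟙 X) := hX.isIso_of_not_rad k hX hn
  rw [spectrum.mem_iff] at hc
  apply hc
  rw [← isUnit_iff_isIso] at hi
  have := hi.neg
  rw [neg_sub] at this
  exact this

omit hfin in
variable {k} in
lemma CIndec.eq_zero_of_rad_smul {X : C} (hX : CIndec X) {c : k} (h : Rad (c • 𝟙 X)) : c = 0 := by
  by_contra hc
  refine hX.1 (h.eq_zero_of_comp_eq_id (g := c⁻¹ • 𝟙 X) ?_)
  simp [hc]

end Indecomposable

section Decomposition

variable {C : Type u} [Category.{v} C] [Preadditive C]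

/-- A finite list of representatives of the isomorphism classes of indecomposable objects. -/
structure IsReps {ι : Type} (M : ι → C) : Prop where
  indec : ∀ i, CIndec (M i)
  inj : ∀ i j, Nonempty (M i ≅ M j) → i = j
  surj : ∀ X : C, CIndec X → ∃ i, Nonempty (X ≅ M i)

/-- A decomposition of `X` as a finite direct sum of copies of the `M i`. -/
structure Decomp {ι : Type} [Fintype ι] (M : ι → C) (X : C) where
  τ : ι → Type
  fin : ∀ i, Fintype (τ i)
  inc : ∀ a : Σ i, τ i, M a.1 ⟶ X
  proj : ∀ a : Σ i, τ i, X ⟶ M a.1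
  inc_proj : ∀ a, inc a ≫ proj a = 𝟙 _
  inc_proj_ne : ∀ a b, a ≠ b → inc a ≫ proj b = 0
  total : ∑ a, proj a ≫ inc a = 𝟙 X

attribute [instance] Decomp.fin

variable {ι : Type} [Fintype ι] {M : ι → C}

/-- The direct sum of two decompositions. -/
def Decomp.sum {X X₁ X₂ : C} (D₁ : Decomp M X₁) (D₂ : Decomp M X₂) (i₁ : X₁ ⟶ X) (r₁ : X ⟶ X₁)
    (i₂ : X₂ ⟶ X) (r₂ : X ⟶ X₂) (h₁ : i₁ ≫ r₁ = 𝟙 X₁) (h₂ : i₂ ≫ r₂ = 𝟙 X₂)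
    (h₁₂ : i₁ ≫ r₂ = 0) (h₂₁ : i₂ ≫ r₁ = 0) (h : r₁ ≫ i₁ + r₂ ≫ i₂ = 𝟙 X) : Decomp M X where
  τ i := D₁.τ i ⊕ D₂.τ i
  fin _ := inferInstance
  inc
    | ⟨i, .inl t⟩ => D₁.inc ⟨i, t⟩ ≫ i₁
    | ⟨i, .inr t⟩ => D₂.inc ⟨i, t⟩ ≫ i₂
  proj
    | ⟨i, .inl t⟩ => r₁ ≫ D₁.proj ⟨i, t⟩
    | ⟨i, .inr t⟩ => r₂ ≫ D₂.proj ⟨i, t⟩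
  inc_proj := by
    rintro ⟨i, t | t⟩
    · simp [reassoc_of% h₁, D₁.inc_proj]
    · simp [reassoc_of% h₂, D₂.inc_proj]
  inc_proj_ne := by
    rintro ⟨i, t | t⟩ ⟨j, s | s⟩ hne
    · simp only [Category.assoc, reassoc_of% h₁]
      refine D₁.inc_proj_ne ⟨i, t⟩ ⟨j, s⟩ fun e ↦ hne ?_
      cases e; rfl
    · simp [reassoc_of% h₁₂]
    · simp [reassoc_of% h₂₁]
    · simp only [Category.assoc, reassoc_of% h₂]
      refine D₂.inc_proj_ne ⟨i, t⟩ ⟨j, s⟩ fun e ↦ hne ?_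
      cases e; rfl
  total := by
    have e₁ := congrArg (fun z ↦ r₁ ≫ z ≫ i₁) D₁.total
    have e₂ := congrArg (fun z ↦ r₂ ≫ z ≫ i₂) D₂.total
    simp only [Fintype.sum_sigma, Preadditive.sum_comp, Preadditive.comp_sum, Category.assoc,
      Category.id_comp] at e₁ e₂
    simp only [Fintype.sum_sigma, Fintype.sum_sum_type, Category.assoc, Finset.sum_add_distrib,
      e₁, e₂, h]

/-- The decomposition of an object isomorphic to one of the `M i`. -/
noncomputable def Decomp.ofIso {X : C} {i : ι} (e : X ≅ M i) : Decomp M X := by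
  classical exact
  { τ j := PLift (j = i)
    fin _ := inferInstance
    inc a := eqToHom (congrArg M a.2.down) ≫ e.inv
    proj a := e.hom ≫ eqToHom (congrArg M a.2.down.symm)
    inc_proj := by simp
    inc_proj_ne := by
      rintro ⟨a, ⟨rfl⟩⟩ ⟨b, ⟨rfl⟩⟩ h
      exact (h rfl).elim
    total := by
      have : Unique (Σ j, PLift (j = i)) :=
        ⟨⟨⟨i, ⟨rfl⟩⟩⟩, by rintro ⟨a, ⟨rfl⟩⟩; rfl⟩
      rw [Fintype.sum_unique]
      simp }

variable (k : Type w) [Field k] [Linear k C] [hfin : ∀ X Y : C, FiniteDimensional k (X ⟶ Y)]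

include k hfin in
lemma finrank_end_lt {X X₁ : C} (i : X₁ ⟶ X) (r : X ⟶ X₁) (h : i ≫ r = 𝟙 X₁)
    (hne : r ≫ i ≠ 𝟙 X) : Module.finrank k (X₁ ⟶ X₁) < Module.finrank k (X ⟶ X) := by
  let φ : (X₁ ⟶ X₁) →ₗ[k] (X ⟶ X) := Linear.leftComp k X r ∘ₗ Linear.rightComp k X₁ i
  have hφ (x : X₁ ⟶ X₁) : φ x = r ≫ x ≫ i := rfl
  have hinj : Function.Injective φ := fun a b hab ↦ by
    have := congrArg (fun z ↦ i ≫ z ≫ r) hab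
    simpa [hφ, h, reassoc_of% h] using this
  have hr : LinearMap.range φ < ⊤ := by
    rw [lt_top_iff_ne_top]
    intro ht
    obtain ⟨x, hx⟩ : 𝟙 X ∈ LinearMap.range φ := ht ▸ Submodule.mem_top
    rw [hφ] at hx
    apply hne
    calc r ≫ i = 𝟙 X ≫ r ≫ i := by simp
      _ = (r ≫ x ≫ i) ≫ r ≫ i := by rw [hx]
      _ = r ≫ x ≫ i := by simp [reassoc_of% h]
      _ = 𝟙 X := hx
  rw [← LinearMap.finrank_range_of_inj hinj]
  exact Submodule.finrank_lt hr.ne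

include k hfin in
lemma IsReps.nonempty_decomp [IsIdempotentComplete C] (hM : IsReps M) (X : C) :
    Nonempty (Decomp M X) := by
  induction hn : Module.finrank k (X ⟶ X) using Nat.strong_induction_on generalizing X with
  | _ n ih =>
  subst hn
  by_cases h0 : 𝟙 X = 0
  · exact ⟨{
      τ _ := PEmpty
      fin _ := inferInstance
      inc a := a.2.elim
      proj a := a.2.elim
      inc_proj a := a.2.elim
      inc_proj_ne a := a.2.elim
      total := (Finset.sum_eq_zero fun a _ ↦ a.2.elim).trans h0.symm }⟩
  by_cases hX : CIndec X
  · obtain ⟨i, ⟨e⟩⟩ := hM.surj X hX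
    exact ⟨Decomp.ofIso e⟩
  · have : ∃ e : X ⟶ X, e ≫ e = e ∧ e ≠ 0 ∧ e ≠ 𝟙 X := by
      by_contra! h
      exact hX ⟨h0, fun e he ↦ or_iff_not_imp_left.2 (h e he)⟩
    obtain ⟨e, he, he0, he1⟩ := this
    obtain ⟨X₁, i₁, r₁, h₁, e₁⟩ := IsIdempotentComplete.idempotents_split X e he
    obtain ⟨X₂, i₂, r₂, h₂, e₂⟩ := IsIdempotentComplete.idempotents_split X (𝟙 X - e)
      (by simp [he])
    have : IsSplitMono i₁ := ⟨⟨⟨r₁, h₁⟩⟩⟩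
    have : IsSplitMono i₂ := ⟨⟨⟨r₂, h₂⟩⟩⟩
    have : IsSplitEpi r₁ := ⟨⟨⟨i₁, h₁⟩⟩⟩
    have : IsSplitEpi r₂ := ⟨⟨⟨i₂, h₂⟩⟩⟩
    obtain ⟨D₁⟩ := ih _ (finrank_end_lt k i₁ r₁ h₁ (by rwa [e₁])) X₁ rfl
    obtain ⟨D₂⟩ := ih _ (finrank_end_lt k i₂ r₂ h₂ (by simpa [e₂] using he0)) X₂ rfl
    refine ⟨D₁.sum D₂ i₁ r₁ i₂ r₂ h₁ h₂ ?_ ?_ (by simp [e₁, e₂])⟩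
    · rw [← cancel_mono i₂, ← cancel_epi r₁]
      simp only [Category.assoc, e₂, zero_comp, comp_zero]
      rw [← Category.assoc, e₁]; simp [he]
    · rw [← cancel_mono i₁, ← cancel_epi r₂]
      simp only [Category.assoc, e₁, zero_comp, comp_zero]
      rw [← Category.assoc, e₂]; simp [he]

end Decomposition

section Irreducible

variable {C : Type u} [Category.{v} C] [Preadditive C]

/-- Irreducible morphisms of a category. -/
def CIrred {X Y : C} (f : X ⟶ Y) : Prop :=
  ¬ IsSplitMono f ∧ ¬ IsSplitEpi f ∧
    ∀ (Z : C) (g : X ⟶ Z) (h : Z ⟶ Y), g ≫ h = f → IsSplitMono g ∨ IsSplitEpi h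

variable [HasBinaryBiproducts C] {k : Type w} [Field k] [Linear k C]

lemma exists_of_mem_rpow_succ {n : ℕ} {X Y : C} {f : X ⟶ Y} (hf : f ∈ rpow k (n + 1) X Y) :
    ∃ (U : C) (g : X ⟶ U) (h : U ⟶ Y), Rad g ∧ h ∈ rpow k n U Y ∧ g ≫ h = f := by
  rw [rpow] at hf
  induction hf using Submodule.span_induction with
  | mem f hf => exact hf
  | zero => exact ⟨X, 0, 0, Rad.zero _ _, zero_mem _, by simp⟩
  | add f₁ f₂ _ _ ih₁ ih₂ =>
    obtain ⟨U₁, g₁, h₁, hg₁, hh₁, rfl⟩ := ih₁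
    obtain ⟨U₂, g₂, h₂, hg₂, hh₂, rfl⟩ := ih₂
    refine ⟨U₁ ⊞ U₂, biprod.lift g₁ g₂, biprod.desc h₁ h₂, ?_, ?_, by simp⟩
    · rw [biprod.lift_eq]
      exact (hg₁.comp_right _).add (hg₂.comp_right _)
    · rw [biprod.desc_eq]
      exact add_mem (rpow_comp_left hh₁ _) (rpow_comp_left hh₂ _)
  | smul c f _ ih =>
    obtain ⟨U, g, h, hg, hh, rfl⟩ := ih
    exact ⟨U, g, c • h, hg, Submodule.smul_mem _ c hh, by simp⟩

lemma exists_of_mem_rpow_succ' {n : ℕ} {X Y : C} {f : X ⟶ Y} (hf : f ∈ rpow k (n + 1) X Y) :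
    ∃ (U : C) (g : X ⟶ U) (h : U ⟶ Y), g ∈ rpow k n X U ∧ Rad h ∧ g ≫ h = f := by
  obtain ⟨U, g, h, hg, hh, e⟩ := exists_of_mem_rpow_succ (op_mem_rpow hf)
  exact ⟨U.unop, h.unop, g.unop, unop_mem_rpow hh, (rad_op_iff g.unop).1 hg,
    Quiver.Hom.op_inj e⟩

variable (k)

lemma CIrred.comp_notMem_rpow_two {X Y W : C} {f : X ⟶ Y} (hf : CIrred f) {s : W ⟶ X} {r : X ⟶ W}
    (hsr : s ≫ r = 𝟙 W) (hW : 𝟙 W ≠ 0) : s ≫ f ∉ rpow k 2 W Y := by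
  intro hmem
  obtain ⟨U, g, h, hg, hh, e⟩ := exists_of_mem_rpow_succ hmem
  rw [mem_rpow_one] at hh
  have hfac : biprod.lift (r ≫ g) (𝟙 X - r ≫ s) ≫ biprod.desc h f = f := by
    simp [e]
  rcases hf.2.2 _ _ _ hfac with h1 | h1
  · obtain ⟨⟨q, hq⟩⟩ := h1
    have := congrArg (fun z ↦ s ≫ z) hq
    rw [biprod.lift_eq] at this
    simp only [Category.assoc, Preadditive.add_comp, Preadditive.sub_comp, Preadditive.comp_add,
      Preadditive.comp_sub, Category.id_comp, reassoc_of% hsr, sub_self, add_zero,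
      Category.comp_id] at this
    refine hW ((hg.eq_zero_of_comp_eq_id (g := biprod.inl ≫ q ≫ r)) ?_)
    rw [← hsr, ← this]
    simp
  · obtain ⟨⟨q, hq⟩⟩ := h1
    rw [biprod.desc_eq, Preadditive.comp_add] at hq
    have hi := hh.swap (q ≫ biprod.fst)
    have e2 : 𝟙 Y - (q ≫ biprod.fst) ≫ h = (q ≫ biprod.snd) ≫ f := by
      rw [← hq]; simp
    rw [e2] at hi
    refine hf.2.1 ⟨⟨inv ((q ≫ biprod.snd) ≫ f) ≫ q ≫ biprod.snd, ?_⟩⟩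
    rw [Category.assoc, IsIso.inv_hom_id]

omit [HasBinaryBiproducts C] [Preadditive C] in
lemma CIrred.op {X Y : C} {f : X ⟶ Y} (hf : CIrred f) : CIrred f.op := by
  refine ⟨fun ⟨⟨s, hs⟩⟩ ↦ hf.2.1 ⟨⟨s.unop, Quiver.Hom.op_inj hs⟩⟩,
    fun ⟨⟨s, hs⟩⟩ ↦ hf.1 ⟨⟨s.unop, Quiver.Hom.op_inj hs⟩⟩, fun Z g h e ↦ ?_⟩
  rcases hf.2.2 Z.unop h.unop g.unop (Quiver.Hom.op_inj e) with ⟨⟨s, hs⟩⟩ | ⟨⟨s, hs⟩⟩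
  · exact .inr ⟨⟨s.op, Quiver.Hom.unop_inj hs⟩⟩
  · exact .inl ⟨⟨s.op, Quiver.Hom.unop_inj hs⟩⟩

lemma CIrred.comp_notMem_rpow_two' {X Y W : C} {f : X ⟶ Y} (hf : CIrred f) {s : W ⟶ Y} {r : Y ⟶ W}
    (hsr : s ≫ r = 𝟙 W) (hW : 𝟙 W ≠ 0) : f ≫ r ∉ rpow k 2 X W := fun hmem ↦
  hf.op.comp_notMem_rpow_two k (s := r.op) (r := s.op) (Quiver.Hom.unop_inj hsr)
    (fun h ↦ hW (Quiver.Hom.op_inj h)) (op_mem_rpow hmem)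

end Irreducible

lemma CIrred.mono_or_epi {C : Type u} [Category.{v} C] [Abelian C] {X Y : C} {f : X ⟶ Y}
    (hf : CIrred f) : Mono f ∨ Epi f := by
  have e := Abelian.image.fac f
  rcases hf.2.2 _ _ _ e with h | h
  · left; rw [← e]; exact mono_comp _ _
  · right; rw [← e]; exact epi_comp _ _

section Nilpotent

variable {C : Type u} [Category.{v} C] [Preadditive C]
variable {ι : Type} [Fintype ι] {M : ι → C}
variable (k : Type w) [Field k] [Linear k C] [hfin : ∀ X Y : C, FiniteDimensional k (X ⟶ Y)]

/-- A morphism is radical as soon as its restrictions to the summands of the source are. -/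
lemma Decomp.rad_of_inc {X Y : C} (D : Decomp M X) {f : X ⟶ Y} (h : ∀ a, Rad (D.inc a ≫ f)) :
    Rad f := by
  rw [← Category.id_comp f, ← D.total, Preadditive.sum_comp]
  exact Rad.sum _ fun a _ ↦ by simpa using (h a).comp_left (D.proj a)

lemma rad_mem_jacobson {T : C} {c : T ⟶ T} (hc : Rad c) :
    (End.of c) ∈ Ring.jacobson (End T) := by
  rw [← Ideal.jacobson_bot, Ideal.mem_jacobson_iff]
  intro y
  have hi := hc (-End.asHom y)
  rw [Preadditive.comp_neg, sub_neg_eq_add] at hi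
  refine ⟨inv (𝟙 T + c ≫ y), ?_⟩
  have := IsIso.hom_inv_id (𝟙 T + c ≫ End.asHom y)
  rw [Preadditive.add_comp, Category.id_comp] at this
  rw [Ideal.mem_bot, sub_eq_zero, add_comm, mul_assoc]
  exact this

include hfin in
lemma IsReps.exists_rpow_eq_bot [IsIdempotentComplete C] [HasFiniteBiproducts C]
    (hM : IsReps M) : ∃ N : ℕ, ∀ X Y : C, rpow k N X Y = ⊥ := by
  let T : C := ⨁ M
  have : FiniteDimensional k (End T) := hfin T T
  have : IsArtinianRing (End T) := IsArtinianRing.of_finite k _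
  let J : Ideal (End T) := Ring.jacobson (End T)
  obtain ⟨N, hN⟩ : IsNilpotent J := IsSemiprimaryRing.isNilpotent
  have key (n : ℕ) (X Y : C) : rpow k n X Y ≤ Submodule.span k
      {f | ∃ (x : X ⟶ T) (c : T ⟶ T) (y : T ⟶ Y), End.of c ∈ J ^ n ∧ x ≫ c ≫ y = f} := by
    induction n generalizing X with
    | zero =>
      intro f _
      obtain ⟨D⟩ := hM.nonempty_decomp k X
      rw [← Category.id_comp f, ← D.total, Preadditive.sum_comp]
      refine sum_mem fun a _ ↦ Submodule.subset_span
        ⟨D.proj a ≫ biproduct.ι M a.1, 𝟙 T, biproduct.π M a.1 ≫ D.inc a ≫ f, ?_, by simp⟩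
      rw [Submodule.pow_zero, Ideal.one_eq_top]
      trivial
    | succ n ih =>
      refine rpow_succ_le fun Z f g hf hg ↦ ?_
      obtain ⟨D⟩ := hM.nonempty_decomp k X
      suffices hle : Submodule.span k {f | ∃ (x : Z ⟶ T) (c : T ⟶ T) (y : T ⟶ Y),
          End.of c ∈ J ^ n ∧ x ≫ c ≫ y = f} ≤ (Submodule.span k {f | ∃ (x : X ⟶ T) (c : T ⟶ T)
            (y : T ⟶ Y), End.of c ∈ J ^ (n + 1) ∧ x ≫ c ≫ y = f}).comap (Linear.leftComp k Y f)
        from hle (ih Z hg)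
      refine Submodule.span_le.2 ?_
      rintro _ ⟨x, c, y, hc, rfl⟩
      rw [SetLike.mem_coe, Submodule.mem_comap, Linear.leftComp_apply]
      rw [← Category.id_comp (f ≫ x ≫ c ≫ y), ← D.total, Preadditive.sum_comp]
      refine sum_mem fun a _ ↦ Submodule.subset_span
        ⟨D.proj a ≫ biproduct.ι M a.1, (biproduct.π M a.1 ≫ D.inc a ≫ f ≫ x) ≫ c, y, ?_, by simp⟩
      rw [Submodule.pow_succ]
      exact Ideal.mul_mem_mul hc (rad_mem_jacobson
        (((hf.comp_right x).comp_left (D.inc a)).comp_left _))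
  refine ⟨N, fun X Y ↦ ?_⟩
  rw [eq_bot_iff]
  refine (key N X Y).trans (Submodule.span_le.2 ?_)
  rintro _ ⟨x, c, y, hc, rfl⟩
  rw [hN] at hc
  have : c = 0 := hc
  simp [this]

end Nilpotent

section Abelian

variable {C : Type u} [Category.{v} C] [Abelian C]

attribute [local instance] Abelian.hasFiniteBiproducts

variable {ι : Type} [Fintype ι] {M : ι → C}
variable (k : Type w) [Field k] [Linear k C] [hfin : ∀ X Y : C, FiniteDimensional k (X ⟶ Y)]

include hfin in
/-- In finite representation type, the kernel of an irreducible epimorphism shows that its left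
degree is finite. -/
lemma CIrred.exists_comp_eq_zero (hM : IsReps M) {X Y : C} {f : X ⟶ Y} (hf : CIrred f) [Epi f] :
    ∃ m : ℕ, 1 ≤ m ∧ ∃ (Z : C) (g : Z ⟶ X),
      g ∈ rpow k m Z X ∧ g ∉ rpow k (m + 1) Z X ∧ g ≫ f = 0 := by
  classical
  have hne : kernel.ι f ≠ 0 := fun h0 ↦ by
    have : Mono f := Preadditive.mono_of_kernel_zero h0
    have : IsIso f := isIso_of_mono_of_epi f
    exact hf.1 inferInstance
  obtain ⟨D⟩ := hM.nonempty_decomp k (kernel f)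
  have hrad : Rad (kernel.ι f) := D.rad_of_inc fun a ↦ by
    by_contra hn
    obtain ⟨r, hr⟩ := (hM.indec a.1).isSplitMono_of_not_rad k hn
    refine hf.comp_notMem_rpow_two k hr (hM.indec a.1).1 ?_
    simp
  obtain ⟨N, hN⟩ := hM.exists_rpow_eq_bot k
  have hex : ∃ n, kernel.ι f ∉ rpow k n _ _ := ⟨N, by rw [hN]; simpa using hne⟩
  have hfind := Nat.find_spec hex
  have h2 : 2 ≤ Nat.find hex := by
    rw [Nat.le_find_iff]
    intro m hm
    interval_cases m
    · simp
    · simpa using hrad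
  refine ⟨Nat.find hex - 1, by omega, _, kernel.ι f, ?_, ?_, kernel.condition f⟩
  · by_contra h
    exact Nat.find_min hex (by omega) h
  · rwa [show Nat.find hex - 1 + 1 = Nat.find hex by omega]

end Abelian

section Middle

attribute [local instance] Abelian.hasFiniteBiproducts

variable {C : Type u} [Category.{v} C] [Abelian C] {ι : Type} [Fintype ι] {M : ι → C}
variable {k : Type w} [Field k] [Linear k C]

/-- The family `V` chooses complements of the square of the radical in the radical. -/
structure RadCompl (V : ∀ i j, Submodule k (M i ⟶ M j)) : Prop where
  rad : ∀ {i j} {f : M i ⟶ M j}, f ∈ V i j → Rad f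
  eq_zero : ∀ {i j} {f : M i ⟶ M j}, f ∈ V i j → f ∈ rpow k 2 (M i) (M j) → f = 0
  le_sup : ∀ i j, radSub k (M i) (M j) ≤ V i j ⊔ rpow k 2 (M i) (M j)

variable (V : ∀ i j, Submodule k (M i ⟶ M j)) {j : ι}

/-- The index type of the summands of `midObj V j`. -/
abbrev MidIdx (j : ι) : Type := Σ i, Fin (Module.finrank k (V i j))

variable (j) in
/-- The object over which all the maps in `V i j` factor universally. -/
noncomputable def midObj : C := ⨁ fun a : MidIdx V j ↦ M a.1

variable {V}

/-- The inclusion of a summand of `midObj V j`. -/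
noncomputable def midIn (a : MidIdx V j) : M a.1 ⟶ midObj V j :=
  biproduct.ι (fun a : MidIdx V j ↦ M a.1) a

/-- The projection onto a summand of `midObj V j`. -/
noncomputable def midOut (a : MidIdx V j) : midObj V j ⟶ M a.1 :=
  biproduct.π (fun a : MidIdx V j ↦ M a.1) a

@[simp] lemma midIn_midOut (a : MidIdx V j) : midIn a ≫ midOut a = 𝟙 (M a.1) :=
  biproduct.ι_π_self _ _

lemma midIn_midOut_ne {a b : MidIdx V j} (h : a ≠ b) : midIn a ≫ midOut b = 0 :=
  biproduct.ι_π_ne _ h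

variable (V j) in
lemma mid_total : ∑ a : MidIdx V j, midOut a ≫ midIn a = 𝟙 (midObj V j) :=
  biproduct.total

lemma eq_sum_midIn {Z : C} (p : Z ⟶ midObj V j) :
    p = ∑ a : MidIdx V j, (p ≫ midOut a) ≫ midIn a := by
  conv_lhs => rw [← Category.comp_id p, ← mid_total, Preadditive.comp_sum]
  simp

lemma mid_ext {Z : C} {p p' : Z ⟶ midObj V j}
    (h : ∀ a : MidIdx V j, p ≫ midOut a = p' ≫ midOut a) : p = p' := by
  rw [eq_sum_midIn p, eq_sum_midIn p']
  simp only [h]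

lemma rad_of_midOut {Z : C} {p : Z ⟶ midObj V j} (h : ∀ a : MidIdx V j, Rad (p ≫ midOut a)) :
    Rad p := by
  rw [eq_sum_midIn p]
  exact Rad.sum _ fun a _ ↦ (h a).comp_right _

variable [hfin : ∀ X Y : C, FiniteDimensional k (X ⟶ Y)]

/-- The basis elements of the spaces `V i j`. -/
noncomputable def arrow (a : MidIdx V j) : M a.1 ⟶ M j := (Module.finBasis k (V a.1 j) a.2).1

variable (V j) in
/-- The map out of `midObj V j` whose components are the basis elements of the `V i j`. -/
noncomputable def midMap : midObj V j ⟶ M j := biproduct.desc arrow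

@[simp] lemma midIn_midMap (a : MidIdx V j) : midIn a ≫ midMap V j = arrow a :=
  biproduct.ι_desc _ _

lemma comp_midMap {Z : C} (p : Z ⟶ midObj V j) :
    p ≫ midMap V j = ∑ a : MidIdx V j, (p ≫ midOut a) ≫ arrow a := by
  conv_lhs => rw [eq_sum_midIn p, Preadditive.sum_comp]
  simp

omit [Fintype ι] in
lemma arrow_mem (a : MidIdx V j) : arrow a ∈ V a.1 j := (Module.finBasis k (V a.1 j) a.2).2

omit [Fintype ι] in
lemma exists_eq_sum_arrow {i : ι} {f : M i ⟶ M j} (hf : f ∈ V i j) :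
    ∃ c : Fin (Module.finrank k (V i j)) → k, ∑ t, c t • arrow ⟨i, t⟩ = f := by
  refine ⟨(Module.finBasis k (V i j)).repr ⟨f, hf⟩, ?_⟩
  have := congrArg Subtype.val ((Module.finBasis k (V i j)).sum_repr ⟨f, hf⟩)
  rwa [Submodule.coe_sum] at this

omit [Fintype ι] in
lemma eq_zero_of_sum_arrow {i : ι} {c : Fin (Module.finrank k (V i j)) → k}
    (h : ∑ t, c t • arrow (⟨i, t⟩ : MidIdx V j) = (0 : M i ⟶ M j)) (t) : c t = 0 := by
  refine Fintype.linearIndependent_iff.1 (Module.finBasis k (V i j)).linearIndependent c ?_ t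
  apply Subtype.ext
  simpa [arrow] using h

namespace RadCompl

variable (hV : RadCompl V)
include hV

omit [Fintype ι] in
lemma rad_arrow (a : MidIdx V j) : Rad (arrow a) := hV.rad (arrow_mem a)

variable (j) in
lemma rad_midMap : Rad (midMap V j) := by
  rw [← Category.id_comp (midMap V j), comp_midMap]
  exact Rad.sum _ fun a _ ↦ (hV.rad_arrow a).comp_left _

variable (hM : IsReps M)
include hM

variable (j) in
lemma rad_le_sup (n : ℕ) (Z : C) : radSub k Z (M j) ≤
    LinearMap.range (Linear.rightComp k Z (midMap V j)) ⊔ rpow k n Z (M j) := by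
  induction n generalizing Z with
  | zero => exact fun f _ ↦ Submodule.mem_sup_right (mem_rpow_zero f)
  | succ n ih =>
    have comp {Z Z' : C} (s : Z ⟶ Z') {m : ℕ} {f : Z' ⟶ M j}
        (hf : f ∈ LinearMap.range (Linear.rightComp k Z' (midMap V j)) ⊔ rpow k m Z' (M j))
        {m' : ℕ} (hs : ∀ g ∈ rpow k m Z' (M j), s ≫ g ∈ rpow k m' Z (M j)) :
        s ≫ f ∈ LinearMap.range (Linear.rightComp k Z (midMap V j)) ⊔ rpow k m' Z (M j) := by
      obtain ⟨_, ⟨h, rfl⟩, g, hg, rfl⟩ := Submodule.mem_sup.1 hf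
      rw [Preadditive.comp_add]
      exact Submodule.add_mem_sup ⟨s ≫ h, by simp⟩ (hs g hg)
    intro f hf
    obtain ⟨D⟩ := hM.nonempty_decomp k Z
    rw [← Category.id_comp f, ← D.total, Preadditive.sum_comp]
    refine sum_mem fun a _ ↦ ?_
    rw [Category.assoc]
    refine comp (D.proj a) ?_ fun g hg ↦ rpow_comp_left hg _
    have h2 : Rad (D.inc a ≫ f) := Rad.comp_left hf _
    obtain ⟨v, hv, r, hr, e⟩ := Submodule.mem_sup.1 (hV.le_sup a.1 j h2)
    rw [← e]
    refine add_mem (Submodule.mem_sup_left ?_) ?_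
    · obtain ⟨c, rfl⟩ := exists_eq_sum_arrow hv
      refine ⟨∑ t, c t • midIn ⟨a.1, t⟩, ?_⟩
      simp
    · obtain ⟨U, g, h, hg, hh, rfl⟩ := exists_of_mem_rpow_succ hr
      exact comp g (ih U (mem_rpow_one.1 hh)) fun g' hg' ↦ comp_mem_rpow_succ hg hg'

/-- Every radical map into `M j` factors through `midMap V j`. -/
lemma exists_comp_midMap {Z : C} {f : Z ⟶ M j} (hf : Rad f) :
    ∃ h : Z ⟶ midObj V j, h ≫ midMap V j = f := by
  obtain ⟨N, hN⟩ := hM.exists_rpow_eq_bot k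
  have := hV.rad_le_sup j hM N Z hf
  rwa [hN, sup_bot_eq] at this

variable [IsAlgClosed k]

omit hV in
lemma exists_rad_sub_sum {i : ι} (u : M i ⟶ midObj V j) :
    ∃ c : Fin (Module.finrank k (V i j)) → k, Rad (u - ∑ t, c t • midIn ⟨i, t⟩) := by
  choose c hc using fun t ↦ (hM.indec i).exists_rad_sub_smul (k := k) (u ≫ midOut ⟨i, t⟩)
  refine ⟨c, rad_of_midOut fun ⟨l, t⟩ ↦ ?_⟩
  rw [Preadditive.sub_comp, Preadditive.sum_comp]
  by_cases hl : l = i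
  · subst hl
    rw [Finset.sum_eq_single t]
    · simpa using hc t
    · intro s _ hs
      rw [Linear.smul_comp, midIn_midOut_ne, smul_zero]
      intro e
      cases e
      exact hs rfl
    · simp
  · rw [Finset.sum_eq_zero, sub_zero]
    · by_contra hn
      have := (hM.indec i).isIso_of_not_rad k (hM.indec l) hn
      exact hl (hM.inj _ _ ⟨asIso (u ≫ midOut ⟨l, t⟩)⟩).symm
    · intro s _
      rw [Linear.smul_comp, midIn_midOut_ne, smul_zero]
      intro e
      cases e
      exact hl rfl

/-- Maps killed by `midMap V j` are radical. -/
lemma rad_of_comp_midMap_eq_zero {Z : C} {u : Z ⟶ midObj V j} (hu : u ≫ midMap V j = 0) :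
    Rad u := by
  obtain ⟨D⟩ := hM.nonempty_decomp k Z
  refine D.rad_of_inc fun a ↦ ?_
  obtain ⟨c, hc⟩ := exists_rad_sub_sum (k := k) hM (D.inc a ≫ u)
  have h2 := neg_mem (comp_mem_rpow_succ (k := k) hc (mem_rpow_one.2 (hV.rad_midMap j)))
  have e : -((D.inc a ≫ u - ∑ t, c t • midIn ⟨a.1, t⟩) ≫ midMap V j) =
      ∑ t, c t • arrow ⟨a.1, t⟩ := by
    simp [Preadditive.sub_comp, Preadditive.sum_comp, hu]
  rw [e] at h2
  have h0 := eq_zero_of_sum_arrow (hV.eq_zero (sum_mem fun t _ ↦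
    Submodule.smul_mem _ _ (arrow_mem (⟨a.1, t⟩ : MidIdx V j))) h2)
  simpa [h0] using hc

/-- Endomorphisms over `M j` of `midObj V j` are invertible. -/
lemma isIso_of_comp_midMap {w : midObj V j ⟶ midObj V j} (hw : w ≫ midMap V j = midMap V j) :
    IsIso w := by
  have := hV.rad_of_comp_midMap_eq_zero hM (u := 𝟙 _ - w)
    (by rw [Preadditive.sub_comp, hw, Category.id_comp, sub_self])
  simpa using this (𝟙 _)

variable (j) in
lemma mono_or_epi_midMap : Mono (midMap V j) ∨ Epi (midMap V j) := by
  have e := Abelian.image.fac (midMap V j)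
  by_cases hm : Rad (Abelian.image.ι (midMap V j))
  · left
    obtain ⟨h, hh⟩ := hV.exists_comp_midMap hM hm
    have : IsIso (Abelian.factorThruImage (midMap V j) ≫ h) :=
      hV.isIso_of_comp_midMap hM (by rw [Category.assoc, hh, e])
    have : Mono (Abelian.factorThruImage (midMap V j)) := mono_of_mono _ h
    rw [← e]
    exact mono_comp _ _
  · right
    obtain ⟨g, hg⟩ := (hM.indec j).isSplitEpi_of_not_rad k hm
    have : IsSplitEpi (Abelian.image.ι (midMap V j)) := ⟨⟨⟨g, hg⟩⟩⟩
    rw [← e]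
    exact epi_comp _ _

end RadCompl

end Middle

section Mesh

attribute [local instance] Abelian.hasFiniteBiproducts

variable {C : Type u} [Category.{v} C] [Abelian C] {ι : Type} [Fintype ι] {M : ι → C}
variable {k : Type w} [Field k] [Linear k C] [hfin : ∀ X Y : C, FiniteDimensional k (X ⟶ Y)]
variable {V : ∀ i j, Submodule k (M i ⟶ M j)} {j : ι}

/-- The map `β` is a kernel of `midMap V j`. -/
structure Mesh {K : C} (β : K ⟶ midObj V j) : Prop where
  mono : Mono β
  comp : β ≫ midMap V j = 0
  lift : ∀ {Z : C} (u : Z ⟶ midObj V j), u ≫ midMap V j = 0 → ∃ v, v ≫ β = u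

variable (V j) in
lemma mesh_kernel : Mesh (kernel.ι (midMap V j)) where
  mono := inferInstance
  comp := kernel.condition _
  lift u hu := ⟨kernel.lift _ u hu, kernel.lift_ι _ _ _⟩

lemma Mesh.iso_comp {K K' : C} {β : K ⟶ midObj V j} (h : Mesh β) (e : K' ⟶ K) [IsIso e] :
    Mesh (e ≫ β) where
  mono := by
    have := h.mono
    exact mono_comp _ _
  comp := by rw [Category.assoc, h.comp, comp_zero]
  lift u hu := by
    obtain ⟨v, rfl⟩ := h.lift u hu
    exact ⟨v ≫ inv e, by simp⟩

lemma Mesh.exists_desc [Epi (midMap V j)] {K W : C} {β : K ⟶ midObj V j} (h : Mesh β)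
    (u : midObj V j ⟶ W) (hu : β ≫ u = 0) : ∃ d, midMap V j ≫ d = u := by
  refine ⟨Abelian.epiDesc (midMap V j) u ?_, Abelian.comp_epiDesc _ _ _⟩
  obtain ⟨v, hv⟩ := h.lift _ (kernel.condition (midMap V j))
  rw [← hv, Category.assoc, hu, comp_zero]

variable [IsAlgClosed k]

namespace RadCompl

variable (hV : RadCompl V) (hM : IsReps M)
include hV hM

/-- A kernel of `midMap V j` is a left almost split map. -/
lemma exists_extension [Epi (midMap V j)] {K W : C} {β : K ⟶ midObj V j} (hβ : Mesh β)
    (u : K ⟶ W) : (∃ w, β ≫ w = u) ∨ ∃ r, u ≫ r = 𝟙 K := by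
  have := hβ.mono
  let p := pushout.desc (f := β) (g := u) (midMap V j) 0 (by rw [hβ.comp, comp_zero])
  have hl : pushout.inl β u ≫ p = midMap V j := pushout.inl_desc _ _ _
  have hr : pushout.inr β u ≫ p = 0 := pushout.inr_desc _ _ _
  have : Epi p := epi_of_epi_fac hl
  have hcok : IsColimit (CokernelCofork.ofπ p hr) :=
    CokernelCofork.IsColimit.ofπ _ _
      (fun s hs ↦ (hβ.exists_desc (pushout.inl β u ≫ s)
        (by rw [pushout.condition_assoc, hs, comp_zero])).choose)
      (fun s hs ↦ by
        apply pushout.hom_ext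
        · rw [← Category.assoc, hl]
          exact (hβ.exists_desc (pushout.inl β u ≫ s)
            (by rw [pushout.condition_assoc, hs, comp_zero])).choose_spec
        · rw [← Category.assoc, hr, zero_comp, hs])
      (fun s hs d hd ↦ by
        rw [← cancel_epi (midMap V j)]
        refine Eq.trans ?_ (hβ.exists_desc (pushout.inl β u ≫ s)
          (by rw [pushout.condition_assoc, hs, comp_zero])).choose_spec.symm
        rw [← hl, Category.assoc, hd])
  have hker {Z : C} (x : Z ⟶ pushout β u) (hx : x ≫ p = 0) : ∃ y, y ≫ pushout.inr β u = x := by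
    obtain ⟨y, hy⟩ := KernelFork.IsLimit.lift' (Abelian.monoIsKernelOfCokernel _ hcok) x hx
    exact ⟨y, hy⟩
  by_cases hp : Rad p
  · right
    obtain ⟨h, hh⟩ := hV.exists_comp_midMap hM hp
    have hw : IsIso (pushout.inl β u ≫ h) :=
      hV.isIso_of_comp_midMap hM (by rw [Category.assoc, hh, hl])
    obtain ⟨v, hv⟩ := hβ.lift (pushout.inr β u ≫ h) (by rw [Category.assoc, hh, hr])
    have e : (u ≫ v) ≫ β = β ≫ pushout.inl β u ≫ h := by
      rw [Category.assoc, hv, pushout.condition_assoc]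
    have : Mono ((u ≫ v) ≫ β) := by rw [e]; exact mono_comp _ _
    have : Mono (u ≫ v) := mono_of_mono _ β
    have : IsIso (u ≫ v) := isIso_of_mono_endo k _
    exact ⟨v ≫ inv (u ≫ v), by rw [← Category.assoc, IsIso.hom_inv_id]⟩
  · left
    obtain ⟨s, hs⟩ := (hM.indec j).isSplitEpi_of_not_rad k hp
    obtain ⟨w, hw⟩ := hker (pushout.inl β u - midMap V j ≫ s)
      (by rw [Preadditive.sub_comp, Category.assoc, hs, hl, Category.comp_id, sub_self])
    refine ⟨w, ?_⟩
    rw [← cancel_mono (pushout.inr β u), Category.assoc, hw, Preadditive.comp_sub,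
      reassoc_of% hβ.comp, zero_comp, sub_zero, pushout.condition]

lemma rad_of_mesh {K : C} {β : K ⟶ midObj V j} (hβ : Mesh β) : Rad β :=
  hV.rad_of_comp_midMap_eq_zero hM hβ.comp

lemma cindec_of_mesh [Epi (midMap V j)] {K : C} {β : K ⟶ midObj V j} (hβ : Mesh β)
    (hK : 𝟙 K ≠ 0) : CIndec K := by
  refine ⟨hK, fun e he ↦ ?_⟩
  rcases hV.exists_extension hM hβ e with ⟨w₁, h₁⟩ | ⟨r, hr⟩
  · rcases hV.exists_extension hM hβ (𝟙 K - e) with ⟨w₂, h₂⟩ | ⟨r, hr⟩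
    · refine (hK ((hV.rad_of_mesh hM hβ).eq_zero_of_comp_eq_id (g := w₁ + w₂) ?_)).elim
      rw [Preadditive.comp_add, h₁, h₂, add_sub_cancel]
    · left
      have : Mono (𝟙 K - e) := mono_of_mono_fac hr
      rw [← cancel_mono (𝟙 K - e)]
      simp [he]
  · right
    have : Mono e := mono_of_mono_fac hr
    rw [← cancel_mono e, he, Category.id_comp]

variable (j) in
lemma mono_or_exists_mesh :
    Mono (midMap V j) ∨ ∃ (i : ι) (β : M i ⟶ midObj V j), Mesh β := by
  by_cases hm : Mono (midMap V j)
  · exact .inl hm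
  right
  have : Epi (midMap V j) := (hV.mono_or_epi_midMap j hM).resolve_left hm
  have hK : 𝟙 (kernel (midMap V j)) ≠ 0 := fun h0 ↦ by
    refine hm (Preadditive.mono_of_kernel_zero ?_)
    rw [← Category.id_comp (kernel.ι _), h0, zero_comp]
  obtain ⟨i, ⟨e⟩⟩ := hM.surj _ (hV.cindec_of_mesh hM (mesh_kernel V j) hK)
  exact ⟨i, e.inv ≫ kernel.ι _, (mesh_kernel V j).iso_comp _⟩

section

variable {i : ι} {β : M i ⟶ midObj V j} (hβ : Mesh β)
include hβ

lemma epi_of_mesh : Epi (midMap V j) := by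
  refine (hV.mono_or_epi_midMap j hM).resolve_left fun hm ↦ ?_
  have h0 : β = 0 := by rw [← cancel_mono (midMap V j), hβ.comp, zero_comp]
  have := hβ.mono
  exact (hM.indec i).1 (by rw [← cancel_mono β, h0, comp_zero, comp_zero])

lemma exists_comp_eq_of_rad {W : C} {u : M i ⟶ W} (hu : Rad u) : ∃ w, β ≫ w = u := by
  have := hV.epi_of_mesh hM hβ
  refine (hV.exists_extension hM hβ u).resolve_right fun ⟨r, hr⟩ ↦ ?_
  exact (hM.indec i).1 (hu.eq_zero_of_comp_eq_id hr)

/-- The Auslander-Reiten translation is injective. -/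
lemma eq_of_mesh {j' : ι} {β' : M i ⟶ midObj V j'} (hβ' : Mesh β') : j = j' := by
  by_contra hne
  have := hV.epi_of_mesh hM hβ
  obtain ⟨w, hw⟩ := hV.exists_comp_eq_of_rad hM hβ (hV.rad_of_mesh hM hβ')
  obtain ⟨z, hz⟩ := hβ.exists_desc (w ≫ midMap V j') (by rw [reassoc_of% hw, hβ'.comp])
  have hzr : Rad z := by
    by_contra hn
    have := (hM.indec j).isIso_of_not_rad k (hM.indec j') hn
    exact hne (hM.inj _ _ ⟨asIso z⟩)
  obtain ⟨h, rfl⟩ := hV.exists_comp_midMap hM hzr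
  obtain ⟨t, ht⟩ := hβ'.lift (w - midMap V j ≫ h)
    (by rw [Preadditive.sub_comp, Category.assoc, hz, sub_self])
  have := hβ'.mono
  refine (hM.indec i).1 ((hV.rad_of_mesh hM hβ).eq_zero_of_comp_eq_id (g := t) ?_)
  rw [← cancel_mono β', Category.assoc, ht, Preadditive.comp_sub, hw, reassoc_of% hβ.comp,
    zero_comp, sub_zero, Category.id_comp]

/-- The components of a mesh map are linearly independent modulo the square of the radical. -/
lemma eq_zero_of_sum_mem_rpow_two {l : ι} {c : Fin (Module.finrank k (V l j)) → k}
    (h : β ≫ ∑ t, c t • midOut (⟨l, t⟩ : MidIdx V j) ∈ rpow k 2 (M i) (M l)) (t) : c t = 0 := by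
  have := hV.epi_of_mesh hM hβ
  obtain ⟨U, g, r, hg, hr, e⟩ := exists_of_mem_rpow_succ h
  rw [mem_rpow_one] at hr
  obtain ⟨w, rfl⟩ := hV.exists_comp_eq_of_rad hM hβ hg
  obtain ⟨d, hd⟩ := hβ.exists_desc ((∑ t, c t • midOut (⟨l, t⟩ : MidIdx V j)) - w ≫ r)
    (by rw [Preadditive.comp_sub, ← e, Category.assoc, sub_self])
  rw [eq_sub_iff_add_eq] at hd
  have hrad := (((hV.rad_midMap j).comp_right d).add (hr.comp_left w)).comp_left
    (midIn (⟨l, t⟩ : MidIdx V j))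
  rw [hd, Preadditive.comp_sum, Finset.sum_eq_single t] at hrad
  · rw [Linear.comp_smul, midIn_midOut] at hrad
    exact (hM.indec l).eq_zero_of_rad_smul hrad
  · intro s _ hs
    rw [Linear.comp_smul, midIn_midOut_ne, smul_zero]
    intro e
    cases e
    exact hs rfl
  · simp

end

variable (V) in
omit hV hM in
/-- The family `V'` is compatible with the kernels of the maps `midMap V j`. -/
def Link (V V' : ∀ i j, Submodule k (M i ⟶ M j)) : Prop :=
  ∀ j, Mono (midMap V j) ∨ ∃ (i : ι) (β : M i ⟶ midObj V j),
    Mesh β ∧ ∀ a : MidIdx V j, β ≫ midOut a ∈ V' i a.1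

end RadCompl

end Mesh

section Link

attribute [local instance] Abelian.hasFiniteBiproducts

variable {C : Type u} [Category.{v} C] [Abelian C] {ι : Type} {M : ι → C}
variable {k : Type w} [Field k] [Linear k C]

lemma exists_radCompl_ge (S : ∀ i j, Submodule k (M i ⟶ M j))
    (hrad : ∀ i j, S i j ≤ radSub k (M i) (M j))
    (hdisj : ∀ i j, ∀ f ∈ S i j, f ∈ rpow k 2 (M i) (M j) → f = 0) :
    ∃ V : ∀ i j, Submodule k (M i ⟶ M j), RadCompl V ∧ ∀ i j, S i j ≤ V i j := by
  have (i j : ι) : ∃ W, S i j ≤ W ∧ IsCompl W (rpow k 2 (M i) (M j)) := by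
    obtain ⟨W, h⟩ := (Submodule.disjoint_def.2 (hdisj i j)).exists_isCompl
    exact ⟨W, h⟩
  choose W hSW hW using this
  refine ⟨fun i j ↦ W i j ⊓ radSub k (M i) (M j), ⟨fun hf ↦ hf.2,
    fun hf h2 ↦ Submodule.disjoint_def.1 (hW _ _).disjoint _ hf.1 h2, fun i j f hf ↦ ?_⟩,
    fun i j ↦ le_inf (hSW i j) (hrad i j)⟩
  obtain ⟨w, hw, r, hr, rfl⟩ := Submodule.mem_sup.1
    ((hW i j).sup_eq_top ▸ Submodule.mem_top : f ∈ W i j ⊔ rpow k 2 (M i) (M j))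
  refine Submodule.add_mem_sup ⟨hw, ?_⟩ hr
  have : r ∈ radSub k (M i) (M j) := mem_rpow_one.1 (rpow_succ_le_self 1 _ _ hr)
  simpa using sub_mem hf this

variable [Fintype ι] [hfin : ∀ X Y : C, FiniteDimensional k (X ⟶ Y)]
variable {V : ∀ i j, Submodule k (M i ⟶ M j)} [IsAlgClosed k]

lemma RadCompl.exists_link (hV : RadCompl V) (hM : IsReps M) :
    ∃ V' : ∀ i j, Submodule k (M i ⟶ M j), RadCompl V' ∧ RadCompl.Link V V' := by
  have (i : ι) : ∃ S : ∀ l, Submodule k (M i ⟶ M l), (∀ l, S l ≤ radSub k (M i) (M l)) ∧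
      (∀ l, ∀ f ∈ S l, f ∈ rpow k 2 (M i) (M l) → f = 0) ∧
      ∀ j (β : M i ⟶ midObj V j), Mesh β → ∃ β' : M i ⟶ midObj V j, Mesh β' ∧
        ∀ a : MidIdx V j, β' ≫ midOut a ∈ S a.1 := by
    by_cases h : ∃ j, ∃ β : M i ⟶ midObj V j, Mesh β
    · obtain ⟨j, β, hβ⟩ := h
      refine ⟨fun l ↦ Submodule.span k
        (Set.range fun t ↦ β ≫ midOut (⟨l, t⟩ : MidIdx V j)), fun l ↦ ?_, fun l f hf h2 ↦ ?_, ?_⟩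
      · rw [Submodule.span_le]
        rintro _ ⟨t, rfl⟩
        exact (hV.rad_of_mesh hM hβ).comp_right _
      · obtain ⟨c, rfl⟩ := (Submodule.mem_span_range_iff_exists_fun k).1 hf
        have e : ∑ t, c t • (β ≫ midOut (⟨l, t⟩ : MidIdx V j)) =
            β ≫ (∑ t, c t • midOut (⟨l, t⟩ : MidIdx V j) : midObj V j ⟶ M l) := by
          simp [Preadditive.comp_sum]
        rw [e] at h2 ⊢
        simp [hV.eq_zero_of_sum_mem_rpow_two hM hβ h2]
      · intro j' β' hβ'
        obtain rfl := hV.eq_of_mesh hM hβ hβ'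
        exact ⟨β, hβ, fun a ↦ Submodule.subset_span ⟨a.2, rfl⟩⟩
    · exact ⟨fun _ ↦ ⊥, fun _ ↦ bot_le, fun _ f hf _ ↦ by simpa using hf,
        fun j β hβ ↦ (h ⟨j, β, hβ⟩).elim⟩
  choose S h₁ h₂ h₃ using this
  obtain ⟨V', hV', hle⟩ := exists_radCompl_ge S h₁ h₂
  refine ⟨V', hV', fun j ↦ ?_⟩
  rcases hV.mono_or_exists_mesh j hM with h | ⟨i, β, hβ⟩
  · exact .inl h
  · obtain ⟨β', hβ', hmem⟩ := h₃ i j β hβ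
    exact .inr ⟨i, β', hβ', fun a ↦ hle _ _ (hmem a)⟩

end Link

section Levels

attribute [local instance] Abelian.hasFiniteBiproducts

variable {C : Type u} [Category.{v} C] [Abelian C] {ι : Type} {M : ι → C}
variable {k : Type w} [Field k] [Linear k C]
variable (V : ℕ → ∀ i j, Submodule k (M i ⟶ M j)) {Z : C} (Q : ∀ j, Submodule k (Z ⟶ M j))

/-- The span of the composites of `m` morphisms in the spaces `V` preceded by a morphism
in `Q`. -/
def lev : ℕ → ∀ (j : ι) (_ : ℕ), Submodule k (Z ⟶ M j)
  | 0, j, _ => Q j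
  | m + 1, j, n => Submodule.span k {f | ∃ (i : ι) (p : Z ⟶ M i) (v : M i ⟶ M j),
      p ∈ lev m i (n + 1) ∧ v ∈ V n i j ∧ p ≫ v = f}

variable {V Q}

lemma comp_mem_lev {m n : ℕ} {i j : ι} {p : Z ⟶ M i} {v : M i ⟶ M j}
    (hp : p ∈ lev V Q m i (n + 1)) (hv : v ∈ V n i j) : p ≫ v ∈ lev V Q (m + 1) j n :=
  Submodule.subset_span ⟨i, p, v, hp, hv, rfl⟩

variable (hV : ∀ n, RadCompl (V n))

include hV in
lemma lev_le_rpow (m : ℕ) (j : ι) (n : ℕ) : lev V Q m j n ≤ rpow k m Z (M j) := by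
  induction m generalizing j n with
  | zero => exact fun f _ ↦ mem_rpow_zero f
  | succ m ih =>
    rw [lev, Submodule.span_le]
    rintro _ ⟨i, p, v, hp, hv, rfl⟩
    exact comp_mem_rpow_succ' (ih i _ hp) ((hV n).rad hv)

variable [Fintype ι] [hfin : ∀ X Y : C, FiniteDimensional k (X ⟶ Y)]

lemma exists_lift_of_mem_lev {m n : ℕ} {j : ι} {q : Z ⟶ M j} (hq : q ∈ lev V Q (m + 1) j n) :
    ∃ p : Z ⟶ midObj (V n) j, p ≫ midMap (V n) j = q ∧
      ∀ a : MidIdx (V n) j, p ≫ midOut a ∈ lev V Q m a.1 (n + 1) := by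
  rw [lev] at hq
  induction hq using Submodule.span_induction with
  | mem f hf =>
    obtain ⟨i, p, v, hp, hv, rfl⟩ := hf
    obtain ⟨c, rfl⟩ := exists_eq_sum_arrow hv
    refine ⟨∑ t, c t • p ≫ midIn ⟨i, t⟩, by simp [Preadditive.comp_sum, Preadditive.sum_comp], fun a ↦ ?_⟩
    rw [Preadditive.sum_comp]
    refine sum_mem fun t _ ↦ ?_
    rw [Linear.smul_comp, Category.assoc]
    refine Submodule.smul_mem _ _ ?_
    by_cases h : ⟨i, t⟩ = a
    · subst h
      simpa using hp
    · rw [midIn_midOut_ne h, comp_zero]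
      exact zero_mem _
  | zero => exact ⟨0, by simp, fun a ↦ by simp⟩
  | add x y _ _ hx hy =>
    obtain ⟨p, rfl, hp⟩ := hx
    obtain ⟨p', rfl, hp'⟩ := hy
    refine ⟨p + p', by simp, fun a ↦ ?_⟩
    rw [Preadditive.add_comp]
    exact add_mem (hp a) (hp' a)
  | smul c x _ hx =>
    obtain ⟨p, rfl, hp⟩ := hx
    refine ⟨c • p, by simp, fun a ↦ ?_⟩
    rw [Linear.smul_comp]
    exact Submodule.smul_mem _ c (hp a)

variable (hM : IsReps M) (hQ : ∀ j, IsCompl (Q j) (radSub k Z (M j)))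
include hV hM hQ

lemma rpow_le_lev_sup (m : ℕ) (j : ι) (n : ℕ) :
    rpow k m Z (M j) ≤ lev V Q m j n ⊔ rpow k (m + 1) Z (M j) := by
  induction m generalizing j n with
  | zero =>
    intro f _
    have : f ∈ Q j ⊔ radSub k Z (M j) := (hQ j).sup_eq_top ▸ Submodule.mem_top
    have e : rpow k 1 Z (M j) = radSub k Z (M j) := by ext; simp
    rwa [lev, zero_add, e]
  | succ m ih =>
    refine rpow_succ_le' fun Y f g hf hg ↦ ?_
    obtain ⟨h, rfl⟩ := (hV n).exists_comp_midMap hM hg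
    rw [← Category.assoc, comp_midMap]
    refine sum_mem fun a _ ↦ ?_
    obtain ⟨x, hx, y, hy, e⟩ := Submodule.mem_sup.1
      (ih a.1 (n + 1) (rpow_comp_right (rpow_comp_right hf h) (midOut a)))
    rw [← e, Preadditive.add_comp]
    exact Submodule.add_mem_sup (comp_mem_lev hx (arrow_mem a))
      (comp_mem_rpow_succ' hy ((hV n).rad_arrow a))

variable [IsAlgClosed k] (hL : ∀ n, RadCompl.Link (V n) (V (n + 1)))
include hL

lemma eq_zero_of_mem_lev (m : ℕ) {j : ι} {n : ℕ} {q : Z ⟶ M j} (hq : q ∈ lev V Q m j n)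
    (hr : q ∈ rpow k (m + 1) Z (M j)) : q = 0 := by
  induction m using Nat.strong_induction_on generalizing j n with
  | _ m ih =>
  cases m with
  | zero =>
    rw [zero_add, mem_rpow_one] at hr
    exact Submodule.disjoint_def.1 (hQ j).disjoint q hq hr
  | succ m =>
    obtain ⟨p, rfl, hp⟩ := exists_lift_of_mem_lev hq
    obtain ⟨U, g, h, hg, hh, e⟩ := exists_of_mem_rpow_succ' hr
    obtain ⟨h, rfl⟩ := (hV n).exists_comp_midMap hM hh
    have hgr := rpow_comp_right hg h
    rw [← Category.assoc] at e
    generalize g ≫ h = r at e hgr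
    suffices hzero : ∃ p₁, p₁ ≫ midMap (V n) j = 0 ∧ p - p₁ ∈ rpow k (m + 1) _ _ ∧
        ∀ a : MidIdx (V n) j, p₁ ≫ midOut a ∈ lev V Q m a.1 (n + 1) by
      obtain ⟨p₁, h0, hr₁, hl₁⟩ := hzero
      have : p = p₁ := mid_ext fun a ↦ by
        rw [← sub_eq_zero, ← Preadditive.sub_comp]
        refine ih m (by omega) (j := a.1) (n := n + 1) ?_ (rpow_comp_right hr₁ _)
        rw [Preadditive.sub_comp]
        exact sub_mem (hp a) (hl₁ a)
      rw [this, h0]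
    rcases hL n j with hm | ⟨i, β, hβ, hβV⟩
    · have : r = p := by rwa [cancel_mono] at e
      exact ⟨0, by simp, by rwa [sub_zero, ← this], by simp⟩
    obtain ⟨v, hv⟩ := hβ.lift (p - r) (by rw [Preadditive.sub_comp, e, sub_self])
    have hβr := (hV n).rad_of_mesh hM hβ
    cases m with
    | zero =>
      refine ⟨0, by simp, ?_, by simp⟩
      rw [sub_zero, ← sub_add_cancel p r, ← hv]
      exact add_mem (mem_rpow_one.2 (hβr.comp_left v)) hgr
    | succ m =>
      have hpr : p ∈ rpow k (m + 1) _ _ := by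
        rw [eq_sum_midIn p]
        exact sum_mem fun a _ ↦ rpow_comp_right (lev_le_rpow hV _ _ _ (hp a)) _
      have hvr (s : ℕ) (hs : s ≤ m) : v ∈ rpow k s Z (M i) := by
        induction s with
        | zero => exact mem_rpow_zero v
        | succ s ihs =>
          obtain ⟨v₁, hv₁, v₂, hv₂, rfl⟩ := Submodule.mem_sup.1
            (rpow_le_lev_sup hV hM hQ s i (n + 2) (ihs (by omega)))
          have hmem : v₁ ≫ β ∈ rpow k (s + 2) _ _ := by
            rw [Preadditive.add_comp, ← eq_sub_iff_add_eq] at hv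
            rw [hv]
            exact sub_mem (sub_mem (rpow_antitone _ _ (by omega) hpr)
              (rpow_antitone _ _ (by omega) hgr)) (comp_mem_rpow_succ' hv₂ hβr)
          have h0 : v₁ ≫ β = 0 := mid_ext fun a ↦ by
            rw [zero_comp]
            refine ih (s + 1) (by omega) (j := a.1) (n := n + 1) ?_ (rpow_comp_right hmem _)
            rw [Category.assoc]
            exact comp_mem_lev hv₁ (hβV a)
          have := hβ.mono
          have h1 : v₁ = 0 := by rw [← cancel_mono β, h0, zero_comp]
          rwa [h1, zero_add]
      obtain ⟨v₁, hv₁, v₂, hv₂, rfl⟩ := Submodule.mem_sup.1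
        (rpow_le_lev_sup hV hM hQ m i (n + 2) (hvr m le_rfl))
      refine ⟨v₁ ≫ β, by rw [Category.assoc, hβ.comp, comp_zero], ?_, fun a ↦ ?_⟩
      · have e₂ : p - v₁ ≫ β = v₂ ≫ β + r := by
          rw [← sub_add_cancel p r, ← hv, Preadditive.add_comp]
          abel
        rw [e₂]
        exact add_mem (comp_mem_rpow_succ' hv₂ hβr) hgr
      · rw [Category.assoc]
        exact comp_mem_lev hv₁ (hβV a)

end Levels

section Irreducible

attribute [local instance] Abelian.hasFiniteBiproducts

variable {C : Type u} [Category.{v} C] [Abelian C] {ι : Type} [Fintype ι] {M : ι → C}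
variable {k : Type w} [Field k] [Linear k C] [hfin : ∀ X Y : C, FiniteDimensional k (X ⟶ Y)]

omit hfin in
lemma Decomp.proj_inc_of_cindec {X : C} (D : Decomp M X) (hM : IsReps M) (hX : CIndec X)
    (a : Σ i, D.τ i) : D.proj a ≫ D.inc a = 𝟙 X := by
  refine (hX.2 (D.proj a ≫ D.inc a) ?_).resolve_left fun h ↦ (hM.indec a.1).1 ?_
  · rw [Category.assoc, reassoc_of% D.inc_proj a]
  · have e : D.inc a ≫ (D.proj a ≫ D.inc a) ≫ D.proj a = 𝟙 (M a.1) := by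
      rw [Category.assoc, reassoc_of% D.inc_proj a, D.inc_proj]
    rw [← e, h, zero_comp, comp_zero]

lemma Decomp.eq_of_cindec {X : C} (D : Decomp M X) (hM : IsReps M) (hX : CIndec X)
    (a b : Σ i, D.τ i) : a = b := by
  by_contra hne
  refine (hM.indec b.1).1 ?_
  rw [← D.inc_proj b, ← Category.id_comp (D.proj b), ← D.proj_inc_of_cindec hM hX a]
  simp [D.inc_proj_ne a b hne]

variable (k) in
include hfin in
lemma CIrred.rad {X Y : C} {f : X ⟶ Y} (hf : CIrred f) (hind : CIndec X ∨ CIndec Y) : Rad f := by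
  by_contra hn
  rcases hind with hX | hY
  · obtain ⟨g, hg⟩ := hX.isSplitMono_of_not_rad k hn
    exact hf.1 ⟨⟨⟨g, hg⟩⟩⟩
  · obtain ⟨g, hg⟩ := hY.isSplitEpi_of_not_rad k hn
    exact hf.2.1 ⟨⟨⟨g, hg⟩⟩⟩

variable (k) in
/-- The components of an irreducible morphism can be extended to complements of the square of the
radical. -/
lemma CIrred.exists_radCompl (hM : IsReps M) {X Y : C} {f : X ⟶ Y} (hf : CIrred f)
    (hind : CIndec X ∨ CIndec Y) (D : Decomp M X) (E : Decomp M Y) :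
    ∃ V : ∀ i j, Submodule k (M i ⟶ M j), RadCompl V ∧
      ∀ a b, D.inc a ≫ f ≫ E.proj b ∈ V a.1 b.1 := by
  refine (exists_radCompl_ge (fun i j ↦ Submodule.span k (Set.range fun s : D.τ i × E.τ j ↦
    D.inc ⟨i, s.1⟩ ≫ f ≫ E.proj ⟨j, s.2⟩)) ?_ ?_).imp fun V ⟨hV, hle⟩ ↦ ?_
  rotate_right
  · exact ⟨hV, fun a b ↦ hle _ _ (Submodule.subset_span ⟨(a.2, b.2), rfl⟩)⟩
  · intro i j
    rw [Submodule.span_le]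
    rintro _ ⟨s, rfl⟩
    exact ((hf.rad k hind).comp_right _).comp_left _
  · intro i j φ hφ h2
    by_contra hne
    have hneD : ∃ s : D.τ i × E.τ j, True := by
      by_contra! h
      have : IsEmpty (D.τ i × E.τ j) := ⟨fun s ↦ h s⟩
      rw [Set.range_eq_empty, Submodule.span_empty] at hφ
      exact hne (by simpa using hφ)
    obtain ⟨⟨s₀, t₀⟩, -⟩ := hneD
    rcases hind with hX | hY
    · have hle : Submodule.span k (Set.range fun s : D.τ i × E.τ j ↦
          D.inc ⟨i, s.1⟩ ≫ f ≫ E.proj ⟨j, s.2⟩) ≤ Submodule.span k (Set.range fun t : E.τ j ↦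
          (D.inc ⟨i, s₀⟩ ≫ f ≫ E.proj ⟨j, t⟩ : M i ⟶ M j)) := by
        rw [Submodule.span_le]
        rintro _ ⟨⟨s, t⟩, rfl⟩
        have : s = s₀ := by simpa using D.eq_of_cindec hM hX ⟨i, s⟩ ⟨i, s₀⟩
        exact Submodule.subset_span ⟨t, by rw [this]⟩
      obtain ⟨c, rfl⟩ := (Submodule.mem_span_range_iff_exists_fun k).1 (hle hφ)
      have h3 := rpow_comp_left h2 (D.proj ⟨i, s₀⟩)
      have e : D.proj ⟨i, s₀⟩ ≫ (∑ t, c t • D.inc ⟨i, s₀⟩ ≫ f ≫ E.proj ⟨j, t⟩ : M i ⟶ M j) =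
          f ≫ (∑ t, c t • E.proj ⟨j, t⟩ : Y ⟶ M j) := by
        simp only [Preadditive.comp_sum, Linear.comp_smul]
        simp only [← Category.assoc, D.proj_inc_of_cindec hM hX, Category.id_comp]
      rw [e] at h3
      obtain ⟨t, ht⟩ : ∃ t, c t ≠ 0 := by
        by_contra! h
        exact hne (by simp [h])
      refine hf.comp_notMem_rpow_two' k (s := (c t)⁻¹ • E.inc ⟨j, t⟩) ?_ (hM.indec j).1 h3
      rw [Preadditive.comp_sum, Finset.sum_eq_single t]
      · have := E.inc_proj ⟨j, t⟩
        simp_all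
      · intro b _ hb
        have := E.inc_proj_ne ⟨j, t⟩ ⟨j, b⟩ (by simpa using hb.symm)
        simp_all
      · simp
    · have hle : Submodule.span k (Set.range fun s : D.τ i × E.τ j ↦
          D.inc ⟨i, s.1⟩ ≫ f ≫ E.proj ⟨j, s.2⟩) ≤ Submodule.span k (Set.range fun s : D.τ i ↦
          (D.inc ⟨i, s⟩ ≫ f ≫ E.proj ⟨j, t₀⟩ : M i ⟶ M j)) := by
        rw [Submodule.span_le]
        rintro _ ⟨⟨s, t⟩, rfl⟩
        have : t = t₀ := by simpa using E.eq_of_cindec hM hY ⟨j, t⟩ ⟨j, t₀⟩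
        exact Submodule.subset_span ⟨s, by rw [this]⟩
      obtain ⟨c, rfl⟩ := (Submodule.mem_span_range_iff_exists_fun k).1 (hle hφ)
      have h3 := rpow_comp_right h2 (E.inc ⟨j, t₀⟩)
      have e : (∑ s, c s • D.inc ⟨i, s⟩ ≫ f ≫ E.proj ⟨j, t₀⟩ : M i ⟶ M j) ≫ E.inc ⟨j, t₀⟩ =
          (∑ s, c s • D.inc ⟨i, s⟩ : M i ⟶ X) ≫ f := by
        simp only [Preadditive.sum_comp, Linear.smul_comp, Category.assoc,
          E.proj_inc_of_cindec hM hY, Category.comp_id]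
      rw [e] at h3
      obtain ⟨s, hs⟩ : ∃ s, c s ≠ 0 := by
        by_contra! h
        exact hne (by simp [h])
      refine hf.comp_notMem_rpow_two k (r := (c s)⁻¹ • D.proj ⟨i, s⟩) ?_ (hM.indec i).1 h3
      rw [Preadditive.sum_comp, Finset.sum_eq_single s]
      · have := D.inc_proj ⟨i, s⟩
        simp_all
      · intro b _ hb
        have := D.inc_proj_ne ⟨i, b⟩ ⟨i, s⟩ (by simpa using hb)
        simp_all
      · simp

variable [IsAlgClosed k]

lemma RadCompl.exists_seq {V : ∀ i j, Submodule k (M i ⟶ M j)} (hV : RadCompl V)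
    (hM : IsReps M) : ∃ W : ℕ → ∀ i j, Submodule k (M i ⟶ M j), W 0 = V ∧
      (∀ n, RadCompl (W n)) ∧ ∀ n, RadCompl.Link (W n) (W (n + 1)) := by
  choose F hF hL using fun V : {V : ∀ i j, Submodule k (M i ⟶ M j) // RadCompl V} ↦
    V.2.exists_link hM
  let W : ℕ → {V : ∀ i j, Submodule k (M i ⟶ M j) // RadCompl V} :=
    fun n ↦ Nat.rec ⟨V, hV⟩ (fun _ V ↦ ⟨F V, hF V⟩) n
  exact ⟨fun n ↦ (W n).1, rfl, fun n ↦ (W n).2, fun n ↦ hL (W n)⟩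

/-- In finite representation type, the left degree of an irreducible monomorphism is infinite. -/
theorem CIrred.mem_rpow_succ (hM : IsReps M) {X Y : C} {f : X ⟶ Y} (hf : CIrred f)
    (hind : CIndec X ∨ CIndec Y) [Mono f] {m : ℕ} {Z : C} {g : Z ⟶ X} (hg : g ∈ rpow k m Z X)
    (hgf : g ≫ f ∈ rpow k (m + 2) Z Y) : g ∈ rpow k (m + 1) Z X := by
  obtain ⟨D⟩ := hM.nonempty_decomp k X
  obtain ⟨E⟩ := hM.nonempty_decomp k Y
  obtain ⟨V, hV, hVf⟩ := hf.exists_radCompl k hM hind D E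
  obtain ⟨W, rfl, hW, hL⟩ := hV.exists_seq hM
  choose Q hQ using fun j ↦ exists_isCompl (radSub k Z (M j))
  have hex (a) := Submodule.mem_sup.1
    (rpow_le_lev_sup hW hM (fun j ↦ (hQ j).symm) m a.1 1 (rpow_comp_right hg (D.proj a)))
  choose x hx y hy hxy using hex
  have hsum : g = ∑ a, x a ≫ D.inc a + ∑ a, y a ≫ D.inc a := by
    rw [← Finset.sum_add_distrib]
    simp only [← Preadditive.add_comp, hxy, Category.assoc]
    rw [← Preadditive.comp_sum, D.total, Category.comp_id]
  have hymem : ∑ a, y a ≫ D.inc a ∈ rpow k (m + 1) Z X :=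
    sum_mem fun a _ ↦ rpow_comp_right (hy a) _
  have hxf : (∑ a, x a ≫ D.inc a) ≫ f = 0 := by
    rw [← Category.comp_id f, ← E.total, Preadditive.comp_sum, Preadditive.comp_sum]
    refine Finset.sum_eq_zero fun b _ ↦ ?_
    rw [← Category.assoc, ← Category.assoc]
    convert zero_comp
    refine eq_zero_of_mem_lev hW hM (fun j ↦ (hQ j).symm) hL (m + 1) (n := 0) ?_ ?_
    · simp only [Preadditive.sum_comp, Category.assoc]
      exact sum_mem fun a _ ↦ comp_mem_lev (hx a) (hVf a b)
    · refine rpow_comp_right ?_ _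
      rw [eq_sub_of_add_eq hsum.symm, Preadditive.sub_comp]
      exact sub_mem hgf (comp_mem_rpow_succ' hymem (hf.rad k hind))
  have h0 : ∑ a, x a ≫ D.inc a = 0 := by rw [← cancel_mono f, hxf, zero_comp]
  rw [hsum, h0, zero_add]
  exact hymem

end Irreducible

section Opposite

variable {C : Type u} [Category.{v} C] [Preadditive C]

lemma CIndec.op {X : C} (hX : CIndec X) : CIndec (Opposite.op X) :=
  ⟨fun h ↦ hX.1 (Quiver.Hom.op_inj h), fun e he ↦
    (hX.2 e.unop (Quiver.Hom.op_inj he)).imp (fun h ↦ Quiver.Hom.unop_inj h)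
      fun h ↦ Quiver.Hom.unop_inj h⟩

lemma CIndec.unop {X : Cᵒᵖ} (hX : CIndec X) : CIndec X.unop :=
  ⟨fun h ↦ hX.1 (Quiver.Hom.unop_inj h), fun e he ↦
    (hX.2 e.op (Quiver.Hom.unop_inj he)).imp (fun h ↦ Quiver.Hom.op_inj h)
      fun h ↦ Quiver.Hom.op_inj h⟩

lemma IsReps.op {ι : Type} {M : ι → C} (hM : IsReps M) :
    IsReps fun i ↦ Opposite.op (M i) where
  indec i := (hM.indec i).op
  inj i j := fun ⟨e⟩ ↦ hM.inj i j ⟨e.unop.symm⟩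
  surj X hX := by
    obtain ⟨i, ⟨e⟩⟩ := hM.surj X.unop hX.unop
    exact ⟨i, ⟨e.symm.op⟩⟩

variable {k : Type w} [Field k] [Linear k C]

lemma finiteDimensional_op (hfin : ∀ X Y : C, FiniteDimensional k (X ⟶ Y)) (X Y : Cᵒᵖ) :
    FiniteDimensional k (X ⟶ Y) :=
  have := hfin Y.unop X.unop
  Module.Finite.equiv (opHomEquiv (k := k) Y.unop X.unop)

end Opposite

section Dual

variable {C : Type u} [Category.{v} C] [Abelian C] {ι : Type} [Fintype ι] {M : ι → C}
variable {k : Type w} [Field k] [Linear k C] [hfin : ∀ X Y : C, FiniteDimensional k (X ⟶ Y)]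

variable (k) in
include hfin in
/-- In finite representation type, the cokernel of an irreducible monomorphism shows that its right
degree is finite. -/
lemma CIrred.exists_comp_eq_zero' (hM : IsReps M) {X Y : C} {f : X ⟶ Y} (hf : CIrred f)
    [Mono f] : ∃ m : ℕ, 1 ≤ m ∧ ∃ (Z : C) (g : Y ⟶ Z),
      g ∈ rpow k m Y Z ∧ g ∉ rpow k (m + 1) Y Z ∧ f ≫ g = 0 := by
  have := finiteDimensional_op hfin
  obtain ⟨m, hm, Z, g, h₁, h₂, h₃⟩ := hf.op.exists_comp_eq_zero k hM.op
  exact ⟨m, hm, Z.unop, g.unop, unop_mem_rpow h₁, fun h ↦ h₂ (op_mem_rpow h),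
    Quiver.Hom.op_inj h₃⟩

variable [IsAlgClosed k]

/-- In finite representation type, the right degree of an irreducible epimorphism is infinite. -/
theorem CIrred.mem_rpow_succ' (hM : IsReps M) {X Y : C} {f : X ⟶ Y} (hf : CIrred f)
    (hind : CIndec X ∨ CIndec Y) [Epi f] {m : ℕ} {Z : C} {g : Y ⟶ Z} (hg : g ∈ rpow k m Y Z)
    (hfg : f ≫ g ∈ rpow k (m + 2) X Z) : g ∈ rpow k (m + 1) Y Z := by
  have := finiteDimensional_op hfin
  exact unop_mem_rpow (hf.op.mem_rpow_succ hM.op (hind.symm.imp CIndec.op CIndec.op)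
    (op_mem_rpow hg) (op_mem_rpow hfg))

end Dual

section Transfer

open ObjectProperty

variable {A : Type} [Ring A] {X Y : FGModuleCat.{0} A}

lemma isIso_hom_iff {f : X ⟶ Y} : IsIso f.hom ↔ IsIso f :=
  ⟨fun h ↦
    have : IsIso ((ModuleCat.isFG A).ι.map f) := h
    (ModuleCat.isFG A).fullyFaithfulι.isIso_of_isIso_map f, fun _ ↦ inferInstance⟩

lemma isSplitMono_hom_iff {f : X ⟶ Y} : IsSplitMono f.hom ↔ IsSplitMono f :=
  ⟨fun ⟨⟨g, hg⟩⟩ ↦ ⟨⟨homMk g, hom_ext _ hg⟩⟩,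
    fun ⟨⟨g, hg⟩⟩ ↦ ⟨⟨g.hom, congrArg InducedCategory.Hom.hom hg⟩⟩⟩

lemma isSplitEpi_hom_iff {f : X ⟶ Y} : IsSplitEpi f.hom ↔ IsSplitEpi f :=
  ⟨fun ⟨⟨g, hg⟩⟩ ↦ ⟨⟨homMk g, hom_ext _ hg⟩⟩,
    fun ⟨⟨g, hg⟩⟩ ↦ ⟨⟨g.hom, congrArg InducedCategory.Hom.hom hg⟩⟩⟩

lemma isRadMor_hom_iff {f : X ⟶ Y} : IsRadMor f.hom ↔ Rad f :=
  ⟨fun h g ↦ isIso_hom_iff.1 (h g.hom), fun h g ↦ isIso_hom_iff.2 (h (homMk g))⟩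

lemma Irred.cirred {f : X ⟶ Y} (hf : Irred f.hom) : CIrred f := by
  refine ⟨fun h ↦ hf.1 (isSplitMono_hom_iff.2 h), fun h ↦ hf.2.1 (isSplitEpi_hom_iff.2 h),
    fun Z g h e ↦ ?_⟩
  exact (hf.2.2 Z.obj Z.property g.hom h.hom (congrArg InducedCategory.Hom.hom e)).imp
    isSplitMono_hom_iff.1 isSplitEpi_hom_iff.1

lemma Indec.of_iso {U V : Mod A} (hU : Indec U) (i : U ≅ V) : Indec V := by
  refine ⟨fun h ↦ hU.1 (h.of_iso i), fun e he ↦ ?_⟩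
  refine (hU.2 (i.hom ≫ e ≫ i.inv) (by simp [reassoc_of% he])).imp (fun h ↦ ?_) fun h ↦ ?_
  · simpa using congrArg (fun t ↦ i.inv ≫ t ≫ i.hom) h
  · simpa using congrArg (fun t ↦ i.inv ≫ t ≫ i.hom) h

lemma indec_obj_iff : Indec X.obj ↔ CIndec X := by
  rw [Indec, CIndec, IsZero.iff_id_eq_zero]
  refine and_congr (not_congr ⟨fun h ↦ hom_ext _ h, fun h ↦ congrArg InducedCategory.Hom.hom h⟩)
    ⟨fun h e he ↦ ?_, fun h e he ↦ ?_⟩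
  · exact (h e.hom (congrArg InducedCategory.Hom.hom he)).imp (fun h ↦ hom_ext _ h)
      fun h ↦ hom_ext _ h
  · exact (h (homMk e) (hom_ext _ he)).imp (fun h ↦ congrArg InducedCategory.Hom.hom h)
      fun h ↦ congrArg InducedCategory.Hom.hom h

lemma surjective_hom_iff_epi [IsNoetherianRing A] {f : X ⟶ Y} :
    Function.Surjective f.hom ↔ Epi f := by
  rw [← ModuleCat.epi_iff_surjective]
  exact ⟨fun _ ↦ (ModuleCat.isFG A).ι.epi_of_epi_map (f := f) ‹_›,
    fun _ ↦ inferInstanceAs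
      (Epi ((forget₂ (FGModuleCat.{0} A) (ModuleCat.{0} A)).map f))⟩

/-- Finite representation type provides a finite complete irredundant family of indecomposable
objects of the category of finitely generated modules. -/
lemma FinRepType.exists_isReps (h : FinRepType A) :
    ∃ (ι : Type) (_ : Finite ι) (M : ι → FGModuleCat.{0} A), IsReps M := by
  obtain ⟨ι, _, M, hM⟩ := h
  let P := {i : ι // FD (M i) ∧ Indec (M i)}
  let N (i : P) : FGModuleCat.{0} A := ⟨M i, i.2.1⟩
  let s : Setoid P := ⟨fun i j ↦ Nonempty (N i ≅ N j), fun _ ↦ ⟨Iso.refl _⟩,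
    fun ⟨e⟩ ↦ ⟨e.symm⟩, fun ⟨e⟩ ⟨e'⟩ ↦ ⟨e ≪≫ e'⟩⟩
  refine ⟨Quotient s, inferInstance, fun q ↦ N q.out, fun q ↦ ?_, fun q r h ↦ ?_, fun X hX ↦ ?_⟩
  · exact indec_obj_iff.1 q.out.2.2
  · exact Quotient.out_equiv_out.1 h
  · have hX' := indec_obj_iff.2 hX
    obtain ⟨i, ⟨e⟩⟩ := hM X.obj X.property hX'
    have hfd : FD (M i) := by
      have : Module.Finite A X.obj := X.property
      exact Module.Finite.equiv e.toLinearEquiv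
    let Y : FGModuleCat.{0} A := ⟨M i, hfd⟩
    let e' : X ≅ Y := isoMk _ e
    have hi : Indec (M i) := hX'.of_iso e
    obtain ⟨e''⟩ := Quotient.mk_out (s := s) (⟨i, hfd, hi⟩ : P)
    exact ⟨⟦⟨i, hfd, hi⟩⟧, ⟨e' ≪≫ e''.symm⟩⟩

variable {k : Type} [Field k] [Algebra k A]

lemma RadComp.homMk_mem_rpow {n : ℕ} {U V : Mod A} {f : U ⟶ V} (hf : RadComp n U V f) (hU : FD U)
    (hV : FD V) : (homMk f : (⟨U, hU⟩ : FGModuleCat.{0} A) ⟶ ⟨V, hV⟩) ∈ rpow k n _ _ := by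
  induction hf with
  | zero f => simp
  | succ hY hf hg ih =>
    exact comp_mem_rpow_succ (Y := (⟨_, hY⟩ : FGModuleCat.{0} A)) (f := homMk _)
      (isRadMor_hom_iff.1 hf) (ih hY hV)

lemma comp_mem_radPow_succ {n : ℕ} {U V W : Mod A} {f : U ⟶ V} {g : V ⟶ W} (hV : FD V)
    (hf : IsRadMor f) (hg : g ∈ radPow k n V W) : f ≫ g ∈ radPow k (n + 1) U W := by
  have : radPow k n V W ≤ (radPow k (n + 1) U W).comap (Linear.leftComp k W f) :=
    Submodule.span_le.2 fun g hg ↦ Submodule.subset_span (RadComp.succ hV hf hg)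
  exact this hg

lemma hom_mem_radPow_iff {n : ℕ} {f : X ⟶ Y} :
    f.hom ∈ radPow k n X.obj Y.obj ↔ f ∈ rpow k n X Y := by
  let e : (X ⟶ Y) ≃ₗ[k] (X.obj ⟶ Y.obj) := InducedCategory.homLinearEquiv
  constructor
  · intro h
    have : radPow k n X.obj Y.obj ≤ (rpow k n X Y).comap e.symm.toLinearMap :=
      Submodule.span_le.2 fun g hg ↦ hg.homMk_mem_rpow X.property Y.property
    exact this h
  · intro h
    induction n generalizing X with
    | zero => exact Submodule.subset_span (.zero _)
    | succ n ih =>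
      have : rpow k (n + 1) X Y ≤ (radPow k (n + 1) X.obj Y.obj).comap
          (InducedCategory.homLinearEquiv : (X ⟶ Y) ≃ₗ[k] (X.obj ⟶ Y.obj)).toLinearMap :=
        rpow_succ_le fun W a b ha hb ↦
          comp_mem_radPow_succ W.property (isRadMor_hom_iff.2 ha) (ih hb)
      exact this h

lemma leftDegBound_hom_iff {f : X ⟶ Y} {m : ℕ} : LeftDegBound k f.hom m ↔
    1 ≤ m ∧ ∃ (Z : FGModuleCat.{0} A) (g : Z ⟶ X),
      g ∈ rpow k m Z X ∧ g ∉ rpow k (m + 1) Z X ∧ g ≫ f ∈ rpow k (m + 2) Z Y := by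
  simp only [← hom_mem_radPow_iff]
  exact and_congr_right fun _ ↦ ⟨fun ⟨Z, hZ, g, h⟩ ↦ ⟨⟨Z, hZ⟩, homMk g, h⟩,
    fun ⟨Z, g, h⟩ ↦ ⟨Z.obj, Z.property, g.hom, h⟩⟩

lemma rightDegBound_hom_iff {f : X ⟶ Y} {m : ℕ} : RightDegBound k f.hom m ↔
    1 ≤ m ∧ ∃ (Z : FGModuleCat.{0} A) (g : Y ⟶ Z),
      g ∈ rpow k m Y Z ∧ g ∉ rpow k (m + 1) Y Z ∧ f ≫ g ∈ rpow k (m + 2) X Z := by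
  simp only [← hom_mem_radPow_iff]
  exact and_congr_right fun _ ↦ ⟨fun ⟨Z, hZ, g, h⟩ ↦ ⟨⟨Z, hZ⟩, homMk g, h⟩,
    fun ⟨Z, g, h⟩ ↦ ⟨Z.obj, Z.property, g.hom, h⟩⟩

lemma leftDeg_eq_top_iff {U V : Mod A} {f : U ⟶ V} :
    leftDeg k f = ⊤ ↔ ∀ m, ¬ LeftDegBound k f m := by
  rw [leftDeg, sInf_eq_top]
  exact ⟨fun h m hm ↦ ENat.natCast_ne_top m (h m ⟨m, rfl, hm⟩), fun h _ ⟨m, _, hm⟩ ↦ (h m hm).elim⟩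

lemma rightDeg_eq_top_iff {U V : Mod A} {f : U ⟶ V} :
    rightDeg k f = ⊤ ↔ ∀ m, ¬ RightDegBound k f m := by
  rw [rightDeg, sInf_eq_top]
  exact ⟨fun h m hm ↦ ENat.natCast_ne_top m (h m ⟨m, rfl, hm⟩), fun h _ ⟨m, _, hm⟩ ↦ (h m hm).elim⟩

variable (k) in
open ModuleCat in
lemma finiteDimensional_fgModuleCat_hom [FiniteDimensional k A] (X Y : FGModuleCat.{0} A) :
    FiniteDimensional k (X ⟶ Y) := by
  have hX : Module.Finite k X.obj := Module.Finite.trans A X.obj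
  have hY : Module.Finite k Y.obj := Module.Finite.trans A Y.obj
  let φ : (X ⟶ Y) →ₗ[k] (X.obj →ₗ[k] Y.obj) :=
    { toFun f := f.hom.hom.restrictScalars k
      map_add' _ _ := rfl
      map_smul' _ _ := rfl }
  refine Module.Finite.of_injective φ fun f g h ↦ ?_
  ext x
  exact LinearMap.congr_fun h x

end Transfer

end ARDegree

namespace ARDegree

open CategoryTheory

/-- **Corollary 3.12.** Let `A` be of finite representation type and `f : X → Y`
irreducible with `X` or `Y` indecomposable. The following are equivalent:
(a) `d_l(f) < ∞`; (b) `d_r(f) = ∞`; (c) `f` is an epimorphism. -/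
theorem finite_rep_type_degree_tfae
    (k A : Type) [Field k] [IsAlgClosed k] [Ring A] [Algebra k A] [FiniteDimensional k A]
    (hrep : FinRepType A) (X Y : Mod A) (hX : FD X) (hY : FD Y)
    (hind : Indec X ∨ Indec Y) (f : X ⟶ Y) (hf : Irred f) :
    ((leftDeg k f ≠ ⊤) ↔ (rightDeg k f = ⊤)) ∧
    ((rightDeg k f = ⊤) ↔ Function.Surjective f) := by
  have : IsNoetherianRing A := IsNoetherianRing.of_finite k A
  have hfin := finiteDimensional_fgModuleCat_hom k (A := A)
  obtain ⟨ι, _, M, hM⟩ := hrep.exists_isReps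
  have := Fintype.ofFinite ι
  let F : (⟨X, hX⟩ : FGModuleCat.{0} A) ⟶ ⟨Y, hY⟩ := ObjectProperty.homMk f
  have hF : CIrred F := Irred.cirred hf
  have hind' := hind.imp (indec_obj_iff (X := ⟨X, hX⟩)).1 (indec_obj_iff (X := ⟨Y, hY⟩)).1
  have hsurj : Function.Surjective f ↔ Epi F := surjective_hom_iff_epi (f := F)
  have hl : leftDeg k f = ⊤ ↔ ∀ m, ¬ LeftDegBound k F.hom m := leftDeg_eq_top_iff
  have hr : rightDeg k f = ⊤ ↔ ∀ m, ¬ RightDegBound k F.hom m := rightDeg_eq_top_iff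
  simp only [leftDegBound_hom_iff] at hl
  simp only [rightDegBound_hom_iff] at hr
  by_cases hepi : Epi F
  · have h₁ : leftDeg k f ≠ ⊤ := fun h ↦ by
      obtain ⟨m, hm, Z, g, hg, hg', h0⟩ := hF.exists_comp_eq_zero k hM
      exact hl.1 h m ⟨hm, Z, g, hg, hg', h0 ▸ zero_mem _⟩
    have h₂ : rightDeg k f = ⊤ := hr.2 fun m ⟨_, Z, g, hg, hg', hfg⟩ ↦
      hg' (hF.mem_rpow_succ' hM hind' hg hfg)
    exact ⟨iff_of_true h₁ h₂, iff_of_true h₂ (hsurj.2 hepi)⟩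
  · have := hF.mono_or_epi.resolve_right hepi
    have h₁ : leftDeg k f = ⊤ := hl.2 fun m ⟨_, Z, g, hg, hg', hgf⟩ ↦
      hg' (hF.mem_rpow_succ hM hind' hg hgf)
    have h₂ : rightDeg k f ≠ ⊤ := fun h ↦ by
      obtain ⟨m, hm, Z, g, hg, hg', h0⟩ := hF.exists_comp_eq_zero' k hM
      exact hr.1 h m ⟨hm, Z, g, hg, hg', h0 ▸ zero_mem _⟩
    exact ⟨iff_of_false (not_not.2 h₁) h₂, iff_of_false h₂ (hsurj.not.2 hepi)⟩

end ARDegree
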